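/- Assume (H) with m > 2d, and adopt the notation of the context (window g, norm ‖·‖_{W^{1,∞}}, kernel E, measure ν). Then for every h ∈ L¹(ℝ^d), setting f(x) := ∫_{ℝ^d} e^{2πi x·ξ} h(ξ) dξ, there exists a unique family (u(t,·))_{t∈[0,∞)} of bounded continuous functions on ℝ^d with ‖u(t,·)‖_{W^{1,∞}} < ∞ for all t, such that t ↦ u(t,·) is continuous with respect to ‖·‖_{W^{1,∞}}, u(0,·) = f, and for every t > 0 and x ∈ ℝ^d, u(t,x) = ∫_{ℝ^d} e^{2πi(x·ξ + tμ(ξ))} h(ξ) dξ + 2πi ∫₀^t ( ∫_{ℝ^d} E(t−s, x−y) u(s,y) dν(y) ) ds, where for each s ∈ (0,t) the inner integral converges absolutely and the function s ↦ ∫ E(t−s,x−y)u(s,y) dν(y) is absolutely integrable on (0,t). -/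

import Mathlib

open MeasureTheory Real Complex
open scoped ENNReal RealInnerProductSpace

noncomputable section

/-- The Gabor (short-time Fourier) transform `V_g v(x,ξ)` of a function `v` with respect to a
Schwartz window `g`. -/
def gaborT (d : ℕ) (g : SchwartzMap (EuclideanSpace ℝ (Fin d)) ℂ)
    (v : EuclideanSpace ℝ (Fin d) → ℂ) (x ξ : EuclideanSpace ℝ (Fin d)) : ℂ :=
  ∫ (y : EuclideanSpace ℝ (Fin d)),
    Complex.exp (-(((2 * Real.pi * ⟪ξ, y⟫ : ℝ) : ℂ) * Complex.I)) * v y *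
      (starRingEnd ℂ) (g (y - x))

/-- The Wiener amalgam `W^{1,∞}` norm `sup_x ∫ |V_g v(x,ξ)| dξ` (valued in `ℝ≥0∞`). -/
def wOneInfNorm (d : ℕ) (g : SchwartzMap (EuclideanSpace ℝ (Fin d)) ℂ)
    (v : EuclideanSpace ℝ (Fin d) → ℂ) : ℝ≥0∞ :=
  ⨆ x : EuclideanSpace ℝ (Fin d),
    ∫⁻ ξ : EuclideanSpace ℝ (Fin d), (‖gaborT d g v x ξ‖₊ : ℝ≥0∞) ∂volume

/-- `u` is a global-in-time solution on `[0,∞)` of the Duhamel formulation of the linear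
problem `(1/2πi)∂_t u = μ(D)u + νu`, `u(0) = f = (h)^∨`, where the finite complex measure `ν`
is represented as `w dρ` with `ρ` a finite positive measure and `w` a bounded density, and
`E(t,·)` is the inverse Fourier transform of `e^{2πitμ}`. -/
def IsGlobalSolution (d : ℕ) (μ : EuclideanSpace ℝ (Fin d) → ℝ)
    (g : SchwartzMap (EuclideanSpace ℝ (Fin d)) ℂ)
    (EE : ℝ → EuclideanSpace ℝ (Fin d) → ℂ)
    (ρ : Measure (EuclideanSpace ℝ (Fin d))) (w : EuclideanSpace ℝ (Fin d) → ℂ)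
    (h : EuclideanSpace ℝ (Fin d) → ℂ)
    (u : ℝ → EuclideanSpace ℝ (Fin d) → ℂ) : Prop :=
  (∀ t ∈ Set.Ici (0 : ℝ),
    Continuous (u t) ∧ (∃ M : ℝ, ∀ x, ‖u t x‖ ≤ M) ∧ wOneInfNorm d g (u t) < ⊤) ∧
  (∀ t ∈ Set.Ici (0 : ℝ), ∀ ε : ℝ, 0 < ε → ∃ δ : ℝ, 0 < δ ∧
    ∀ s ∈ Set.Ici (0 : ℝ), |s - t| < δ →
      wOneInfNorm d g (fun x => u s x - u t x) < ENNReal.ofReal ε) ∧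
  (∀ x, u 0 x =
    ∫ (ξ : EuclideanSpace ℝ (Fin d)),
      Complex.exp (((2 * Real.pi * ⟪x, ξ⟫ : ℝ) : ℂ) * Complex.I) * h ξ) ∧
  (∀ t : ℝ, 0 < t → ∀ x : EuclideanSpace ℝ (Fin d),
    (∀ s ∈ Set.Ioo (0 : ℝ) t,
      Integrable (fun y => EE (t - s) (x - y) * u s y * w y) ρ) ∧
    IntegrableOn (fun s => ∫ y, EE (t - s) (x - y) * u s y * w y ∂ρ)
      (Set.Ioo (0 : ℝ) t) volume ∧
    u t x =
      (∫ (ξ : EuclideanSpace ℝ (Fin d)),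
        Complex.exp (((2 * Real.pi * (⟪x, ξ⟫ + t * μ ξ) : ℝ) : ℂ) * Complex.I) * h ξ) +
      (2 * (Real.pi : ℂ)) * Complex.I *
        ∫ s in Set.Ioo (0 : ℝ) t, ∫ y, EE (t - s) (x - y) * u s y * w y ∂ρ)


open MeasureTheory Real Complex
open scoped ENNReal RealInnerProductSpace

section geom

variable {V : Type*} [NormedAddCommGroup V] [InnerProductSpace ℝ V] [FiniteDimensional ℝ V]

/-- gradient homogeneity -/
lemma fderiv_homog {W : Type*} [NormedAddCommGroup W] [NormedSpace ℝ W] {F : V → W} {U : Set V}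
    (hU : IsOpen U) {c r : ℝ} (hc : 0 < c)
    (hhom : ∀ x ∈ U, F (c • x) = c ^ r • F x)
    {x : V} (hx : x ∈ U) (hd1 : DifferentiableAt ℝ F x) (hd2 : DifferentiableAt ℝ F (c • x)) :
    fderiv ℝ F (c • x) = c ^ (r - 1) • fderiv ℝ F x := by
  have h1 : HasFDerivAt (fun y => F (c • y)) (c • fderiv ℝ F (c • x)) x := by
    have := hd2.hasFDerivAt.comp x ((hasFDerivAt_id x).const_smul c)
    have e : c • fderiv ℝ F (c • x) = (fderiv ℝ F (c • x)).comp (c • ContinuousLinearMap.id ℝ V) := by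
      ext v; simp
    rw [e]
    exact this
  have h2 : HasFDerivAt (fun y => F (c • y)) (c ^ r • fderiv ℝ F x) x := by
    have := hd1.hasFDerivAt.const_smul (c ^ r)
    refine this.congr_of_eventuallyEq ?_
    filter_upwards [hU.mem_nhds hx] with y hy
    simpa using hhom y hy
  have h3 := h1.unique h2
  have : fderiv ℝ F (c • x) = c⁻¹ • (c • fderiv ℝ F (c • x)) := by
    rw [smul_smul, inv_mul_cancel₀ hc.ne', one_smul]
  rw [this, h3, smul_smul, Real.rpow_sub hc, Real.rpow_one]
  congr 1
  field_simp

lemma local_lower (m : ℝ) (hm : 2 ≤ m) (μ : V → ℝ)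
    (hsmooth : ContDiffOn ℝ (⊤ : ℕ∞) μ {x | x ≠ 0})
    (hhom : ∀ c : ℝ, 0 < c → ∀ x : V, x ≠ 0 → μ (c • x) = c ^ m * μ x)
    (hhess : ∀ x : V, ‖x‖ = 1 → Function.Bijective ⇑(fderiv ℝ (fderiv ℝ μ) x))
    (ω₀ : V) (hω₀ : ‖ω₀‖ = 1) :
    ∃ U : Set V, IsOpen U ∧ ω₀ ∈ U ∧ ∃ c : ℝ, 0 < c ∧ ∀ a ∈ U, ∀ b ∈ U, ‖a‖ = 1 → ‖b‖ = 1 →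
      ∀ s : ℝ, 0 < s → s ≤ 1 →
      c * ‖a - s • b‖ ≤ ‖fderiv ℝ μ a - s ^ (m - 1) • fderiv ℝ μ b‖ := by
  have hopen : IsOpen {x : V | x ≠ 0} := isOpen_ne
  have hne : ∀ x : V, ‖x‖ = 1 → x ≠ 0 := fun x hx h => by simp [h] at hx
  have hdiff : ∀ x : V, x ≠ 0 → ContDiffAt ℝ (⊤ : ℕ∞) μ x := fun x hx =>
    hsmooth.contDiffAt (hopen.mem_nhds hx)
  have hGhom : ∀ c : ℝ, 0 < c → ∀ x : V, x ≠ 0 →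
      fderiv ℝ μ (c • x) = c ^ (m - 1) • fderiv ℝ μ x := by
    intro c hc x hx
    refine fderiv_homog hopen hc (fun y hy => by simpa using hhom c hc y hy) hx ?_ ?_
    · exact (hdiff x hx).differentiableAt (by simp)
    · exact (hdiff _ (smul_ne_zero hc.ne' hx)).differentiableAt (by simp)
  set G := fderiv ℝ μ with hG
  have hGsm : ContDiffAt ℝ (⊤ : ℕ∞) G ω₀ := by
    refine (hdiff ω₀ (hne _ hω₀)).fderiv_right ?_
    simp
  have hstrict : HasStrictFDerivAt G (fderiv ℝ G ω₀) ω₀ := hGsm.hasStrictFDerivAt (by simp)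
  have hG0 : G ω₀ ≠ 0 := by
    intro h0
    have h1 : HasDerivAt (fun s : ℝ => G (s • ω₀)) (fderiv ℝ G ω₀ ω₀) 1 := by
      have h2 : HasDerivAt (fun s : ℝ => s • ω₀) ω₀ 1 := by
        simpa using (hasDerivAt_id (1:ℝ)).smul_const ω₀
      have h3 : HasFDerivAt G (fderiv ℝ G ω₀) ((1:ℝ) • ω₀) := by
        rw [one_smul]; exact hstrict.hasFDerivAt
      exact h3.comp_hasDerivAt 1 h2
    have h2 : HasDerivAt (fun s : ℝ => G (s • ω₀)) 0 1 := by
      refine (hasDerivAt_const (1:ℝ) (0 : V →L[ℝ] ℝ)).congr_of_eventuallyEq ?_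
      filter_upwards [lt_mem_nhds (zero_lt_one : (0:ℝ) < 1)] with s hs
      rw [hGhom s hs ω₀ (hne _ hω₀), h0, smul_zero]
    have h3 : fderiv ℝ G ω₀ ω₀ = 0 := h1.unique h2
    have h4 := (hhess ω₀ hω₀).1 (h3.trans (map_zero _).symm)
    exact hne _ hω₀ h4
  -- antilipschitz
  obtain ⟨c₀, hc₀, r, hr, hanti⟩ : ∃ c₀ : ℝ, 0 < c₀ ∧ ∃ r : ℝ, 0 < r ∧
      ∀ a ∈ Metric.ball ω₀ r, ∀ b ∈ Metric.ball ω₀ r, c₀ * ‖a - b‖ ≤ ‖G a - G b‖ := by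
    let e : V ≃L[ℝ] (V →L[ℝ] ℝ) :=
      (LinearEquiv.ofBijective (fderiv ℝ G ω₀ : V →ₗ[ℝ] (V →L[ℝ] ℝ)) (hhess ω₀ hω₀)).toContinuousLinearEquiv
    have he : ∀ v, e v = fderiv ℝ G ω₀ v := fun v => rfl
    obtain ⟨K, hK, hKb⟩ : ∃ K : ℝ, 0 < K ∧ ∀ v, ‖v‖ ≤ K * ‖fderiv ℝ G ω₀ v‖ := by
      refine ⟨‖(e.symm : (V →L[ℝ] ℝ) →L[ℝ] V)‖ + 1, by positivity, fun v => ?_⟩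
      have := (e.symm : (V →L[ℝ] ℝ) →L[ℝ] V).le_opNorm (e v)
      simp only [ContinuousLinearEquiv.coe_coe, ContinuousLinearEquiv.symm_apply_apply] at this
      rw [he] at this
      nlinarith [norm_nonneg (fderiv ℝ G ω₀ v)]
    have h1 := hstrict.isLittleO.def (show (0:ℝ) < 1 / (2 * K) by positivity)
    obtain ⟨r, hr, hrb⟩ := Metric.eventually_nhds_iff.1 h1
    refine ⟨1 / (2 * K), by positivity, r, hr, fun a ha b hb => ?_⟩
    have h2 := @hrb (a, b) (by rw [Prod.dist_eq]; exact max_lt ha hb)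
    simp only at h2
    have h3 := hKb (a - b)
    have h4 : ‖fderiv ℝ G ω₀ (a - b)‖ ≤ ‖G a - G b - fderiv ℝ G ω₀ (a - b)‖ + ‖G a - G b‖ := by
      have := norm_sub_le (G a - G b) (G a - G b - fderiv ℝ G ω₀ (a - b))
      rw [sub_sub_cancel] at this; linarith
    have h5 : ‖a - b‖ / K ≤ ‖fderiv ℝ G ω₀ (a - b)‖ := by
      rw [div_le_iff₀ hK]; linarith
    have h6 : ‖a - b‖ / K = 1 / (2 * K) * ‖a - b‖ + 1 / (2 * K) * ‖a - b‖ := by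
      field_simp; ring
    linarith
  set δ : ℝ := min (r / 2) (1 / 2) with hδ
  have hδ0 : 0 < δ := by rw [hδ]; positivity
  have hδr : δ ≤ r / 2 := min_le_left _ _
  have hg0 : 0 < ‖G ω₀‖ := norm_pos_iff.2 hG0
  set ε : ℝ := δ * ‖G ω₀‖ / 4 with hε
  have hε0 : 0 < ε := by positivity
  obtain ⟨r2, hr2, hr2b⟩ := Metric.continuousAt_iff.1 hGsm.continuousAt ε hε0
  refine ⟨Metric.ball ω₀ (min δ r2), Metric.isOpen_ball, Metric.mem_ball_self (by positivity),
    min c₀ ε, by positivity, ?_⟩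
  intro a ha b hb hna hnb s hs hs1
  have ha1 : dist a ω₀ < δ := lt_of_lt_of_le ha (min_le_left _ _)
  have hb1 : dist b ω₀ < δ := lt_of_lt_of_le hb (min_le_left _ _)
  have ha2 := hr2b (lt_of_lt_of_le (Metric.mem_ball.1 ha) (min_le_right _ _))
  have hb2 := hr2b (lt_of_lt_of_le (Metric.mem_ball.1 hb) (min_le_right _ _))
  by_cases hsd : 1 - δ ≤ s
  · rw [← hGhom s hs b (hne _ hnb)]
    refine le_trans ?_ (hanti a ?_ (s • b) ?_)
    · gcongr; exact min_le_left _ _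
    · rw [Metric.mem_ball]; linarith
    · rw [Metric.mem_ball, dist_eq_norm]
      have : s • b - ω₀ = (b - ω₀) - (1 - s) • b := by module
      rw [this]
      refine lt_of_le_of_lt (norm_sub_le _ _) ?_
      rw [norm_smul, hnb, Real.norm_of_nonneg (by linarith), ← dist_eq_norm]
      linarith
  · push Not at hsd
    have hp : s ^ (m - 1) ≤ s := by
      simpa using Real.rpow_le_rpow_of_exponent_ge hs hs1 (show (1:ℝ) ≤ m - 1 by linarith)
    have hp0 : 0 ≤ s ^ (m - 1) := by positivity
    set p := s ^ (m - 1)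
    have h1 : ‖a - s • b‖ ≤ 2 := by
      refine (norm_sub_le _ _).trans ?_
      rw [norm_smul, hna, hnb, Real.norm_of_nonneg hs.le]; linarith
    have h2 : (1 - p) * ‖G ω₀‖ ≤ ‖G a - p • G b‖ + ‖G a - G ω₀‖ + p * ‖G b - G ω₀‖ := by
      have : (1 - p) • G ω₀ = (G a - p • G b) - (G a - G ω₀) + p • (G b - G ω₀) := by module
      calc (1 - p) * ‖G ω₀‖ = ‖(1 - p) • G ω₀‖ := by
            rw [norm_smul, Real.norm_of_nonneg (by linarith)]
        _ ≤ _ := by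
            rw [this]
            refine (norm_add_le _ _).trans ?_
            rw [norm_smul, Real.norm_of_nonneg hp0]
            gcongr
            exact norm_sub_le _ _
    rw [← dist_eq_norm (G a) (G ω₀), ← dist_eq_norm (G b)] at h2
    have h3 : δ * ‖G ω₀‖ ≤ (1 - p) * ‖G ω₀‖ := by gcongr; linarith
    have h4 : p * dist (G b) (G ω₀) ≤ 1 * ε := by gcongr; linarith
    have h5 : min c₀ ε * ‖a - s • b‖ ≤ ε * 2 := by
      gcongr; exact min_le_right _ _
    have : δ * ‖G ω₀‖ = 4 * ε := by rw [hε]; ring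
    linarith

lemma cone_lower (m : ℝ) (hm : 2 ≤ m) (μ : V → ℝ)
    (hsmooth : ContDiffOn ℝ (⊤ : ℕ∞) μ {x | x ≠ 0})
    (hhom : ∀ c : ℝ, 0 < c → ∀ x : V, x ≠ 0 → μ (c • x) = c ^ m * μ x)
    (hhess : ∀ x : V, ‖x‖ = 1 → Function.Bijective ⇑(fderiv ℝ (fderiv ℝ μ) x)) :
    ∃ (ι : Type) (_ : Fintype ι) (Γ : ι → Set V), (∀ x : V, x ≠ 0 → ∃ i, x ∈ Γ i) ∧
      ∃ c : ℝ, 0 < c ∧ ∀ i, ∀ x ∈ Γ i, ∀ y ∈ Γ i, x ≠ 0 → y ≠ 0 →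
        c * (max ‖x‖ ‖y‖) ^ (m - 2) * ‖x - y‖ ≤ ‖fderiv ℝ μ x - fderiv ℝ μ y‖ := by
  have hopen : IsOpen {x : V | x ≠ 0} := isOpen_ne
  have hdiff : ∀ x : V, x ≠ 0 → ContDiffAt ℝ (⊤ : ℕ∞) μ x := fun x hx =>
    hsmooth.contDiffAt (hopen.mem_nhds hx)
  have hGhom : ∀ c : ℝ, 0 < c → ∀ x : V, x ≠ 0 →
      fderiv ℝ μ (c • x) = c ^ (m - 1) • fderiv ℝ μ x := by
    intro c hc x hx
    refine fderiv_homog hopen hc (fun y hy => by simpa using hhom c hc y hy) hx ?_ ?_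
    · exact (hdiff x hx).differentiableAt (by simp)
    · exact (hdiff _ (smul_ne_zero hc.ne' hx)).differentiableAt (by simp)
  have hloc := local_lower m hm μ hsmooth hhom hhess
  choose! U hUo hUm c hc hcb using hloc
  obtain ⟨t, ht, htc⟩ := (isCompact_sphere (0:V) 1).elim_nhds_subcover U
    (fun x hx => (hUo x (by simpa using hx)).mem_nhds (hUm x (by simpa using hx)))
  obtain ⟨c0, hc0, hc0t⟩ : ∃ c0 : ℝ, 0 < c0 ∧ ∀ x ∈ t, c0 ≤ c x := by
    by_cases hte : t.Nonempty
    · obtain ⟨x, hx, hxm⟩ := t.exists_min_image c hte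
      exact ⟨c x, hc x (by simpa using ht x hx), hxm⟩
    · rw [Finset.not_nonempty_iff_eq_empty] at hte
      exact ⟨1, one_pos, by simp [hte]⟩
  have hunit : ∀ x : V, x ≠ 0 → ‖‖x‖⁻¹ • x‖ = 1 := fun x hx => by
    rw [norm_smul, norm_inv, norm_norm, inv_mul_cancel₀ (norm_ne_zero_iff.2 hx)]
  refine ⟨Fin t.card, inferInstance, fun i => {x | ‖x‖⁻¹ • x ∈ U (t.equivFin.symm i : V)}, ?_,
    c0, hc0, ?_⟩
  · intro x hx
    have h1 := htc (show ‖x‖⁻¹ • x ∈ Metric.sphere (0:V) 1 by simpa using hunit x hx)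
    simp only [Set.mem_iUnion] at h1
    obtain ⟨z, hz, hzU⟩ := h1
    exact ⟨t.equivFin ⟨z, hz⟩, by simpa using hzU⟩
  · intro i
    -- wlog
    have key : ∀ x y : V, ‖x‖⁻¹ • x ∈ U (t.equivFin.symm i : V) →
        ‖y‖⁻¹ • y ∈ U (t.equivFin.symm i : V) → x ≠ 0 → y ≠ 0 → ‖y‖ ≤ ‖x‖ →
        c0 * (max ‖x‖ ‖y‖) ^ (m - 2) * ‖x - y‖ ≤ ‖fderiv ℝ μ x - fderiv ℝ μ y‖ := by
      intro x y hx hy hx0 hy0 hle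
      set z := (t.equivFin.symm i : V)
      have hzt : z ∈ t := (t.equivFin.symm i).2
      have hz1 : ‖z‖ = 1 := by simpa using ht z hzt
      have hxp : 0 < ‖x‖ := norm_pos_iff.2 hx0
      have hyp : 0 < ‖y‖ := norm_pos_iff.2 hy0
      have h1 := hcb z hz1 _ hx _ hy (hunit x hx0) (hunit y hy0) (‖y‖ / ‖x‖) (by positivity)
        ((div_le_one hxp).2 hle)
      have e1 : ‖x‖⁻¹ • x - (‖y‖ / ‖x‖) • ‖y‖⁻¹ • y = ‖x‖⁻¹ • (x - y) := by
        rw [smul_smul, smul_sub]; congr 2; field_simp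
      have e2 : fderiv ℝ μ (‖x‖⁻¹ • x) - (‖y‖ / ‖x‖) ^ (m - 1) • fderiv ℝ μ (‖y‖⁻¹ • y)
          = (‖x‖⁻¹) ^ (m - 1) • (fderiv ℝ μ x - fderiv ℝ μ y) := by
        rw [hGhom _ (by positivity) x hx0, hGhom _ (by positivity) y hy0, smul_smul, smul_sub,
          ← Real.mul_rpow (by positivity) (by positivity)]
        congr 3; field_simp
      rw [e1, e2, norm_smul, norm_smul, Real.norm_of_nonneg (by positivity),
        Real.norm_of_nonneg (by positivity)] at h1
      rw [max_eq_left hle]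
      have h2 : c0 * (‖x‖⁻¹ * ‖x - y‖) ≤ ‖x‖⁻¹ ^ (m - 1) * ‖fderiv ℝ μ x - fderiv ℝ μ y‖ :=
        le_trans (by gcongr; exact hc0t z hzt) h1
      rw [Real.inv_rpow hxp.le] at h2
      have h3 : ‖x‖ ^ (m - 1) = ‖x‖ ^ (m - 2) * ‖x‖ := by
        rw [show m - 1 = (m - 2) + 1 by ring, Real.rpow_add_one hxp.ne']
      have h4 : 0 < ‖x‖ ^ (m - 2) := by positivity
      rw [h3] at h2
      calc c0 * ‖x‖ ^ (m - 2) * ‖x - y‖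
          = (‖x‖ ^ (m - 2) * ‖x‖) * (c0 * (‖x‖⁻¹ * ‖x - y‖)) := by field_simp
        _ ≤ (‖x‖ ^ (m - 2) * ‖x‖) * ((‖x‖ ^ (m - 2) * ‖x‖)⁻¹ * ‖fderiv ℝ μ x - fderiv ℝ μ y‖) := by
            gcongr
        _ = _ := by field_simp
    intro x hx y hy hx0 hy0
    rcases le_total ‖y‖ ‖x‖ with hle | hle
    · exact key x y hx hy hx0 hy0 hle
    · rw [max_comm, norm_sub_rev, norm_sub_rev (fderiv ℝ μ x)]
      exact key y x hy hx hy0 hx0 hle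

end geom

open MeasureTheory Real Complex
open scoped ENNReal RealInnerProductSpace

section integ

variable {V : Type*} [NormedAddCommGroup V] [InnerProductSpace ℝ V] [FiniteDimensional ℝ V]
  [MeasurableSpace V] [BorelSpace V]

lemma lint_smul (f : V → ℝ≥0∞) (hf : Measurable f) (r : ℝ) (hr : 0 < r) :
    ∫⁻ x, f (r • x) = ENNReal.ofReal ((r ^ Module.finrank ℝ V)⁻¹) * ∫⁻ x, f x := by
  have h1 := Measure.map_addHaar_smul (volume : Measure V) hr.ne'
  rw [abs_of_nonneg (by positivity)] at h1
  rw [← lintegral_map hf (measurable_const_smul r), h1, lintegral_smul_measure, smul_eq_mul]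

lemma cone_integral (m : ℝ) (hm : 2 ≤ m) (μ : V → ℝ)
    (hsmooth : ContDiffOn ℝ (⊤ : ℕ∞) μ {x | x ≠ 0})
    (hhom : ∀ c : ℝ, 0 < c → ∀ x : V, x ≠ 0 → μ (c • x) = c ^ m * μ x)
    (hhess : ∀ x : V, ‖x‖ = 1 → Function.Bijective ⇑(fderiv ℝ (fderiv ℝ μ) x)) (r : ℝ)
    (hr : (Module.finrank ℝ V : ℝ) < r) :
    ∃ C : ℝ≥0∞, C ≠ ⊤ ∧ ∀ κ : ℝ, 0 < κ → κ ≤ 1 → ∀ X : V →L[ℝ] ℝ,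
      ∫⁻ ξ in {ξ : V | 1 < ‖κ • ξ‖}, ENNReal.ofReal ((1 + ‖X + κ • fderiv ℝ μ (κ • ξ)‖ /
        (1 + ‖κ • ξ‖) ^ (m - 2)) ^ (-r)) ≤
      C * ENNReal.ofReal (((κ ^ 2) ^ Module.finrank ℝ V)⁻¹) := by
  obtain ⟨ι, _, Γ, hΓ, c, hc, hcb⟩ := cone_lower m hm μ hsmooth hhom hhess
  have hr0 : 0 < r := lt_of_le_of_lt (Nat.cast_nonneg _) hr
  set c' : ℝ := c / 2 ^ (m - 2) with hc'
  have hc'0 : 0 < c' := by positivity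
  set c'' : ℝ := min (1 / 2) (c' / 2) with hc''
  have hc''0 : 0 < c'' := by positivity
  set I0 : ℝ≥0∞ := ∫⁻ x : V, ENNReal.ofReal ((1 + ‖x‖) ^ (-r)) with hI0
  have hI0t : I0 < ⊤ := finite_integral_one_add_norm hr
  refine ⟨(Fintype.card ι : ℝ≥0∞) * (ENNReal.ofReal (c'' ^ (-r)) * I0), ?_, ?_⟩
  · exact ENNReal.mul_ne_top (by simp) (ENNReal.mul_ne_top (by simp) hI0t.ne)
  intro κ hκ hκ1 X
  have hX : ∀ ξ : V, ‖X + κ • fderiv ℝ μ (κ • ξ)‖ = κ * ‖κ⁻¹ • X + fderiv ℝ μ (κ • ξ)‖ := by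
    intro ξ
    rw [← Real.norm_of_nonneg hκ.le, ← norm_smul, smul_add, smul_smul, Real.norm_of_nonneg hκ.le,
      mul_inv_cancel₀ hκ.ne', one_smul]
  set Y := κ⁻¹ • X
  set q : V → ℝ := fun ζ => ‖Y + fderiv ℝ μ ζ‖ / (1 + ‖ζ‖) ^ (m - 2) with hq
  have hq0 : ∀ ζ, 0 ≤ q ζ := fun ζ => by positivity
  have hmin : ∀ i, ∃ z : V, ∀ ζ ∈ Γ i, 1 < ‖ζ‖ → c' * ‖ζ - z‖ ≤ 2 * q ζ + 1 := by
    intro i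
    by_cases hne : (Γ i ∩ {ζ | 1 < ‖ζ‖}).Nonempty
    · have hne2 : (q '' (Γ i ∩ {ζ | 1 < ‖ζ‖})).Nonempty := hne.image q
      obtain ⟨_, ⟨z, ⟨hz1, hz2⟩, rfl⟩, hlt⟩ := Real.lt_sInf_add_pos hne2 one_pos
      refine ⟨z, fun ζ hζ hζ1 => ?_⟩
      have hbdd : BddBelow (q '' (Γ i ∩ {ζ | 1 < ‖ζ‖})) := ⟨0, by rintro _ ⟨a, _, rfl⟩; exact hq0 a⟩
      have h1 : q z ≤ q ζ + 1 := by
        have := csInf_le hbdd ⟨ζ, ⟨hζ, hζ1⟩, rfl⟩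
        linarith
      simp only [Set.mem_setOf_eq] at hz2
      have hζ0 : ζ ≠ 0 := norm_pos_iff.1 (by linarith)
      have hz0 : z ≠ 0 := norm_pos_iff.1 (by linarith)
      have h2 := hcb i ζ hζ z hz1 hζ0 hz0
      set M := max ‖ζ‖ ‖z‖
      have hM1 : ‖ζ‖ ≤ M := le_max_left _ _
      have hM2 : ‖z‖ ≤ M := le_max_right _ _
      have hMp : 0 < M := by linarith
      have hm2 : 0 ≤ m - 2 := by linarith
      have h3 : ‖Y + fderiv ℝ μ ζ‖ ≤ q ζ * (2 * M) ^ (m - 2) := by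
        calc _ = q ζ * (1 + ‖ζ‖) ^ (m - 2) := by
              rw [hq]; field_simp
          _ ≤ _ := by
              have := hq0 ζ
              gcongr; linarith
      have h4 : ‖Y + fderiv ℝ μ z‖ ≤ (q ζ + 1) * (2 * M) ^ (m - 2) := by
        calc _ = q z * (1 + ‖z‖) ^ (m - 2) := by
              rw [hq]; field_simp
          _ ≤ _ := by
              have := hq0 ζ
              gcongr; linarith
      have h5 : ‖fderiv ℝ μ ζ - fderiv ℝ μ z‖ ≤ ‖Y + fderiv ℝ μ ζ‖ + ‖Y + fderiv ℝ μ z‖ := by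
        have := norm_sub_le (Y + fderiv ℝ μ ζ) (Y + fderiv ℝ μ z)
        rwa [add_sub_add_left_eq_sub] at this
      have hMm : 0 < M ^ (m - 2) := by positivity
      rw [Real.mul_rpow (by norm_num) hMp.le] at h3 h4
      have h2m : (0:ℝ) < 2 ^ (m - 2) := by positivity
      have h6 : c * ‖ζ - z‖ * M ^ (m - 2) ≤ ((2 * q ζ + 1) * 2 ^ (m - 2)) * M ^ (m - 2) := by
        nlinarith
      have h7 := le_of_mul_le_mul_right h6 hMm
      rw [hc', div_mul_eq_mul_div, div_le_iff₀ h2m]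
      exact h7
    · refine ⟨0, fun ζ hζ hζ1 => absurd ⟨ζ, hζ, hζ1⟩ hne⟩
  choose z hz using hmin
  set g : ι → V → ℝ≥0∞ := fun i ξ =>
    ENNReal.ofReal (c'' ^ (-r)) * ENNReal.ofReal ((1 + ‖κ ^ 2 • (ξ - κ⁻¹ • z i)‖) ^ (-r)) with hg
  have hpt : ∀ ξ : V, 1 < ‖κ • ξ‖ → ENNReal.ofReal ((1 + ‖X + κ • fderiv ℝ μ (κ • ξ)‖ /
        (1 + ‖κ • ξ‖) ^ (m - 2)) ^ (-r)) ≤ ∑ i, g i ξ := by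
    intro ξ hξ
    have h0 : κ • ξ ≠ 0 := norm_pos_iff.1 (by linarith)
    obtain ⟨i, hi⟩ := hΓ _ h0
    refine le_trans ?_ (Finset.single_le_sum (f := fun i => g i ξ) (fun _ _ => zero_le)
      (Finset.mem_univ i))
    rw [hg]
    simp only
    rw [← ENNReal.ofReal_mul (by positivity), ← Real.mul_rpow hc''0.le (by positivity)]
    apply ENNReal.ofReal_le_ofReal
    apply Real.rpow_le_rpow_of_nonpos (by positivity) _ (by linarith)
    have h1 := hz i _ hi hξ
    have h2 : ‖κ • ξ - z i‖ = κ * ‖ξ - κ⁻¹ • z i‖ := by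
      rw [← Real.norm_of_nonneg hκ.le, ← norm_smul, smul_sub, smul_smul, Real.norm_of_nonneg hκ.le,
        mul_inv_cancel₀ hκ.ne', one_smul]
    rw [norm_smul, Real.norm_of_nonneg (by positivity), hX, mul_div_assoc]
    change c'' * (1 + κ ^ 2 * ‖ξ - κ⁻¹ • z i‖) ≤ 1 + κ * q (κ • ξ)
    rw [h2] at h1
    set D := ‖ξ - κ⁻¹ • z i‖
    have hD : 0 ≤ D := norm_nonneg _
    have hc1 : c'' ≤ 1 / 2 := min_le_left _ _
    have hc2 : c'' ≤ c' / 2 := min_le_right _ _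
    have h3 : κ * (c' * (κ * D)) ≤ κ * (2 * q (κ • ξ) + 1) := by gcongr
    have h4 : c'' * (κ ^ 2 * D) ≤ c' / 2 * (κ ^ 2 * D) := by gcongr
    nlinarith
  have hms : MeasurableSet {ξ : V | 1 < ‖κ • ξ‖} :=
    (isOpen_lt continuous_const (continuous_const_smul κ).norm).measurableSet
  have hgm : ∀ i, Measurable (g i) := fun i => by
    apply Measurable.const_mul
    fun_prop
  calc _ ≤ ∫⁻ ξ in {ξ : V | 1 < ‖κ • ξ‖}, ∑ i, g i ξ := setLIntegral_mono' hms hpt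
    _ ≤ ∫⁻ ξ, ∑ i, g i ξ := setLIntegral_le_lintegral _ _
    _ = ∑ i, ∫⁻ ξ, g i ξ := lintegral_finset_sum _ (fun i _ => hgm i)
    _ = ∑ i : ι, ENNReal.ofReal (c'' ^ (-r)) * (ENNReal.ofReal (((κ ^ 2) ^ Module.finrank ℝ V)⁻¹) * I0) := by
        refine Finset.sum_congr rfl fun i _ => ?_
        rw [hg]
        simp only
        have hm1 : Measurable (fun x : V => ENNReal.ofReal ((1 + ‖x‖) ^ (-r))) := by fun_prop
        rw [lintegral_const_mul _ (by fun_prop),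
          lintegral_sub_right_eq_self (fun x : V => ENNReal.ofReal ((1 + ‖κ ^ 2 • x‖) ^ (-r))),
          lint_smul (fun x : V => ENNReal.ofReal ((1 + ‖x‖) ^ (-r))) hm1 _ (by positivity)]
    _ = _ := by
        rw [Finset.sum_const, Finset.card_univ, nsmul_eq_mul]; ring

end integ

open MeasureTheory Real Complex
open scoped ENNReal RealInnerProductSpace

set_option linter.unusedSectionVars false

noncomputable section

/-- the character `e^{2π i r}` -/
def ex (r : ℝ) : ℂ := Complex.exp (((2 * Real.pi * r : ℝ) : ℂ) * Complex.I)

lemma ex_def (r : ℝ) : ex r = Complex.exp (((2 * Real.pi * r : ℝ) : ℂ) * Complex.I) := rfl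

@[simp] lemma norm_ex (r : ℝ) : ‖ex r‖ = 1 := Complex.norm_exp_ofReal_mul_I _

lemma ex_add (a b : ℝ) : ex (a + b) = ex a * ex b := by
  rw [ex, ex, ex, ← Complex.exp_add]; congr 1; push_cast; ring

@[simp] lemma ex_zero : ex 0 = 1 := by simp [ex]

@[fun_prop] lemma continuous_ex : Continuous ex := by unfold ex; fun_prop

lemma ex_hasDerivAt {f : ℝ → ℝ} {f' t : ℝ} (hf : HasDerivAt f f' t) :
    HasDerivAt (fun s => ex (f s)) (2 * Real.pi * Complex.I * f' * ex (f t)) t := by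
  unfold ex
  have h1 : HasDerivAt (fun s => (((2 * Real.pi * f s : ℝ) : ℂ) * Complex.I))
      (((2 * Real.pi * f' : ℝ) : ℂ) * Complex.I) t :=
    ((hf.const_mul (2 * Real.pi)).ofReal_comp).mul_const _
  have := h1.cexp
  convert this using 1
  push_cast; ring

section nonstat

variable {V : Type*} [NormedAddCommGroup V] [InnerProductSpace ℝ V] [FiniteDimensional ℝ V]
  [MeasurableSpace V] [BorelSpace V]

/-- smooth functions homogeneous of degree `r` outside the unit ball -/
def HH {W : Type*} [NormedAddCommGroup W] [NormedSpace ℝ W] (r : ℝ) (F : V → W) : Prop :=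
  ContDiff ℝ (⊤ : ℕ∞) F ∧ ∀ c : ℝ, 1 ≤ c → ∀ x : V, 1 < ‖x‖ → F (c • x) = c ^ r • F x

lemma HH.fderiv {W : Type*} [NormedAddCommGroup W] [NormedSpace ℝ W] {r : ℝ} {F : V → W}
    (h : HH r F) : HH (r - 1) (fderiv ℝ F) := by
  refine ⟨h.1.fderiv_right (by simp), fun c hc x hx => ?_⟩
  have hd : Differentiable ℝ F := h.1.differentiable (by simp)
  have ho : IsOpen {x : V | 1 < ‖x‖} := isOpen_lt continuous_const continuous_norm
  have hc0 : 0 < c := by linarith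
  have h1 : HasFDerivAt (fun y => F (c • y)) (c • _root_.fderiv ℝ F (c • x)) x := by
    have := (hd (c • x)).hasFDerivAt.comp x ((hasFDerivAt_id x).const_smul c)
    have e : c • _root_.fderiv ℝ F (c • x)
        = (_root_.fderiv ℝ F (c • x)).comp (c • ContinuousLinearMap.id ℝ V) := by
      ext v; simp
    rw [e]
    exact this
  have h2 : HasFDerivAt (fun y => F (c • y)) (c ^ r • _root_.fderiv ℝ F x) x := by
    have := (hd x).hasFDerivAt.const_smul (c ^ r)
    refine this.congr_of_eventuallyEq ?_
    filter_upwards [ho.mem_nhds hx] with y hy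
    simpa using h.2 c hc y hy
  have h3 := h1.unique h2
  have : _root_.fderiv ℝ F (c • x) = c⁻¹ • (c • _root_.fderiv ℝ F (c • x)) := by
    rw [smul_smul, inv_mul_cancel₀ hc0.ne', one_smul]
  rw [this, h3, smul_smul, Real.rpow_sub hc0, Real.rpow_one]
  congr 1
  field_simp

lemma HH.dir {W : Type*} [NormedAddCommGroup W] [NormedSpace ℝ W] {r : ℝ} {F : V → W}
    (h : HH r F) (e : V) : HH (r - 1) (fun x => _root_.fderiv ℝ F x e) := by
  have := h.fderiv
  refine ⟨this.1.clm_apply contDiff_const, fun c hc x hx => ?_⟩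
  simp only
  rw [this.2 c hc x hx]; rfl

lemma HH.bound {W : Type*} [NormedAddCommGroup W] [NormedSpace ℝ W] {r s : ℝ} {F : V → W}
    (h : HH r F) (hrs : r ≤ s) (hs : 0 ≤ s) : ∃ C : ℝ, 0 ≤ C ∧ ∀ x, ‖F x‖ ≤ C * (1 + ‖x‖) ^ s := by
  obtain ⟨C, hC⟩ := (isCompact_closedBall (0:V) 2).exists_bound_of_continuousOn
    h.1.continuous.continuousOn
  have hC0 : 0 ≤ C := (norm_nonneg _).trans (hC 0 (by simp))
  refine ⟨C, hC0, fun x => ?_⟩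
  rcases le_or_gt ‖x‖ 2 with hx | hx
  · have h1 := hC x (by simpa using hx)
    have h2 : (1:ℝ) ≤ (1 + ‖x‖) ^ s := Real.one_le_rpow (by linarith [norm_nonneg x]) hs
    nlinarith
  · have hx0 : ‖x‖ ≠ 0 := by positivity
    have hc : 1 ≤ ‖x‖ / 2 := by linarith
    have hy : ‖(2 / ‖x‖) • x‖ = 2 := by
      rw [norm_smul, Real.norm_of_nonneg (by positivity)]; field_simp
    have h1 := h.2 (‖x‖ / 2) hc ((2 / ‖x‖) • x) (by rw [hy]; norm_num)
    rw [smul_smul, show ‖x‖ / 2 * (2 / ‖x‖) = 1 by field_simp, one_smul] at h1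
    rw [h1, norm_smul, Real.norm_of_nonneg (by positivity), mul_comm]
    have h2 := hC ((2 / ‖x‖) • x) (by simp [hy])
    have h3 : (‖x‖ / 2) ^ r ≤ (1 + ‖x‖) ^ s :=
      (Real.rpow_le_rpow_of_exponent_le hc hrs).trans
        (Real.rpow_le_rpow (by positivity) (by linarith) hs)
    gcongr

/-- base amplitude bounds -/
def SyB (s : ℝ) (n : ℕ) (a : ℝ → V → V → ℂ) : Prop :=
  (∀ κ ξ, Continuous (a κ ξ)) ∧ ∀ P : ℕ, ∃ C : ℝ, 0 ≤ C ∧ ∀ κ : ℝ, 0 < κ → κ ≤ 1 → ∀ ξ η,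
    ‖a κ ξ η‖ * (1 + ‖η‖) ^ P ≤ C * ((1 + ‖κ • ξ‖) ^ s) ^ n

/-- amplitudes with `k` derivatives in direction `e` -/
def Sy (e : V) (s : ℝ) (n : ℕ) : ℕ → (ℝ → V → V → ℂ) → Prop
  | 0, a => SyB s n a
  | k + 1, a => SyB s n a ∧ ∃ a' : ℝ → V → V → ℂ,
      (∀ κ ξ η, HasLineDerivAt ℝ (a κ ξ) (a' κ ξ η) η e) ∧ Sy e s n k a'

/-- base multiplier bounds -/
def MuB (s : ℝ) (a : ℝ → V → V → ℂ) : Prop :=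
  (∀ κ ξ, Continuous (a κ ξ)) ∧ ∃ P : ℕ, ∃ C : ℝ, 0 ≤ C ∧ ∀ κ : ℝ, 0 < κ → κ ≤ 1 → ∀ ξ η,
    ‖a κ ξ η‖ ≤ C * (1 + ‖η‖) ^ P * (1 + ‖κ • ξ‖) ^ s

/-- multipliers with `k` derivatives in direction `e` -/
def Mu (e : V) (s : ℝ) : ℕ → (ℝ → V → V → ℂ) → Prop
  | 0, a => MuB s a
  | k + 1, a => MuB s a ∧ ∃ a' : ℝ → V → V → ℂ,
      (∀ κ ξ η, HasLineDerivAt ℝ (a κ ξ) (a' κ ξ η) η e) ∧ Mu e s k a'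


lemma Sy.base {e : V} {s : ℝ} {n k : ℕ} {a : ℝ → V → V → ℂ} (h : Sy e s n k a) : SyB s n a := by
  cases k with
  | zero => exact h
  | succ k => exact h.1

lemma Mu.base {e : V} {s : ℝ} {k : ℕ} {a : ℝ → V → V → ℂ} (h : Mu e s k a) : MuB s a := by
  cases k with
  | zero => exact h
  | succ k => exact h.1

lemma Sy.down {e : V} {s : ℝ} {n k : ℕ} {a : ℝ → V → V → ℂ} (h : Sy e s n (k + 1) a) :
    Sy e s n k a := by
  induction k generalizing a with
  | zero => exact h.1
  | succ k ih =>
    obtain ⟨h1, a', h2, h3⟩ := h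
    exact ⟨h1, a', h2, ih h3⟩

lemma Mu.down {e : V} {s : ℝ} {k : ℕ} {a : ℝ → V → V → ℂ} (h : Mu e s (k + 1) a) :
    Mu e s k a := by
  induction k generalizing a with
  | zero => exact h.1
  | succ k ih =>
    obtain ⟨h1, a', h2, h3⟩ := h
    exact ⟨h1, a', h2, ih h3⟩

lemma SyB.lin {s : ℝ} {n : ℕ} {a b : ℝ → V → V → ℂ} (ha : SyB s n a) (hb : SyB s n b) (c : ℂ) :
    SyB s n (fun κ ξ η => c * a κ ξ η + b κ ξ η) := by
  refine ⟨fun κ ξ => (continuous_const.mul (ha.1 κ ξ)).add (hb.1 κ ξ), fun P => ?_⟩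
  obtain ⟨C1, h10, h1⟩ := ha.2 P
  obtain ⟨C2, h20, h2⟩ := hb.2 P
  refine ⟨‖c‖ * C1 + C2, by positivity, fun κ hκ hκ1 ξ η => ?_⟩
  have hn : ‖c * a κ ξ η + b κ ξ η‖ ≤ ‖c‖ * ‖a κ ξ η‖ + ‖b κ ξ η‖ := by
    refine (norm_add_le _ _).trans ?_
    rw [norm_mul]
  calc _ ≤ (‖c‖ * ‖a κ ξ η‖ + ‖b κ ξ η‖) * (1 + ‖η‖) ^ P := by gcongr
    _ = ‖c‖ * (‖a κ ξ η‖ * (1 + ‖η‖) ^ P) + ‖b κ ξ η‖ * (1 + ‖η‖) ^ P := by ring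
    _ ≤ ‖c‖ * (C1 * ((1 + ‖κ • ξ‖) ^ s) ^ n) + C2 * ((1 + ‖κ • ξ‖) ^ s) ^ n :=
        add_le_add (mul_le_mul_of_nonneg_left (h1 κ hκ hκ1 ξ η) (norm_nonneg _)) (h2 κ hκ hκ1 ξ η)
    _ = _ := by ring

lemma hasLine_add {e : V} {a b : V → ℂ} {a' b' : ℂ} {η : V} (c : ℂ)
    (ha : HasLineDerivAt ℝ a a' η e) (hb : HasLineDerivAt ℝ b b' η e) :
    HasLineDerivAt ℝ (fun η => c * a η + b η) (c * a' + b') η e := by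
  unfold HasLineDerivAt at *
  exact (ha.const_mul c).add hb

lemma hasLine_mul {e : V} {a b : V → ℂ} {a' b' : ℂ} {η : V}
    (ha : HasLineDerivAt ℝ a a' η e) (hb : HasLineDerivAt ℝ b b' η e) :
    HasLineDerivAt ℝ (fun η => a η * b η) (a' * b η + a η * b') η e := by
  unfold HasLineDerivAt at *
  have h := HasDerivAt.mul ha hb
  simp only [zero_smul, add_zero] at h
  exact h

lemma Sy.lin {e : V} {s : ℝ} {n k : ℕ} {a b : ℝ → V → V → ℂ} (ha : Sy e s n k a)
    (hb : Sy e s n k b) (c : ℂ) : Sy e s n k (fun κ ξ η => c * a κ ξ η + b κ ξ η) := by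
  induction k generalizing a b with
  | zero => exact SyB.lin ha hb c
  | succ k ih =>
    obtain ⟨h1, a', h2, h3⟩ := ha
    obtain ⟨h1', b', h2', h3'⟩ := hb
    exact ⟨h1.lin h1' c, _, fun κ ξ η => hasLine_add c (h2 κ ξ η) (h2' κ ξ η), ih h3 h3'⟩

lemma SyB.mul {s : ℝ} {n : ℕ} {a q : ℝ → V → V → ℂ} (hq : MuB s q) (ha : SyB s n a) :
    SyB s (n + 1) (fun κ ξ η => q κ ξ η * a κ ξ η) := by
  refine ⟨fun κ ξ => (hq.1 κ ξ).mul (ha.1 κ ξ), fun P => ?_⟩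
  obtain ⟨Q, C1, h10, h1⟩ := hq.2
  obtain ⟨C2, h20, h2⟩ := ha.2 (P + Q)
  refine ⟨C1 * C2, by positivity, fun κ hκ hκ1 ξ η => ?_⟩
  rw [norm_mul]
  calc _ ≤ (C1 * (1 + ‖η‖) ^ Q * (1 + ‖κ • ξ‖) ^ s) * ‖a κ ξ η‖ * (1 + ‖η‖) ^ P := by
        gcongr; exact h1 κ hκ hκ1 ξ η
    _ = C1 * (1 + ‖κ • ξ‖) ^ s * (‖a κ ξ η‖ * (1 + ‖η‖) ^ (P + Q)) := by ring
    _ ≤ C1 * (1 + ‖κ • ξ‖) ^ s * (C2 * ((1 + ‖κ • ξ‖) ^ s) ^ n) := by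
        exact mul_le_mul_of_nonneg_left (h2 κ hκ hκ1 ξ η) (by positivity)
    _ = _ := by ring

lemma Sy.mul {e : V} {s : ℝ} {n k : ℕ} {a q : ℝ → V → V → ℂ} (hq : Mu e s k q)
    (ha : Sy e s n k a) : Sy e s (n + 1) k (fun κ ξ η => q κ ξ η * a κ ξ η) := by
  induction k generalizing a q with
  | zero => exact SyB.mul hq ha
  | succ k ih =>
    have hqd := hq.down
    have had := ha.down
    obtain ⟨h1, a', h2, h3⟩ := ha
    obtain ⟨h1', b', h2', h3'⟩ := hq
    refine ⟨SyB.mul h1' h1, _, fun κ ξ η => hasLine_mul (h2' κ ξ η) (h2 κ ξ η), ?_⟩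
    have := (ih h3' had).lin (ih hqd h3) 1
    simpa using this

lemma Sy.up {e : V} {s : ℝ} (hs : 0 ≤ s) {n k : ℕ} {a : ℝ → V → V → ℂ} (ha : Sy e s n k a) :
    Sy e s (n + 1) k a := by
  have hB : ∀ {a : ℝ → V → V → ℂ}, SyB s n a → SyB s (n + 1) a := by
    intro a ha
    refine ⟨ha.1, fun P => ?_⟩
    obtain ⟨C2, h20, h2⟩ := ha.2 P
    refine ⟨C2, h20, fun κ hκ hκ1 ξ η => (h2 κ hκ hκ1 ξ η).trans ?_⟩
    have : (1:ℝ) ≤ (1 + ‖κ • ξ‖) ^ s := Real.one_le_rpow (by linarith [norm_nonneg (κ • ξ)]) hs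
    exact mul_le_mul_of_nonneg_left (pow_le_pow_right₀ this (Nat.le_succ n)) h20
  induction k generalizing a with
  | zero => exact hB ha
  | succ k ih =>
    obtain ⟨h1, a', h2, h3⟩ := ha
    exact ⟨hB h1, a', h2, ih h3⟩

end nonstat

open MeasureTheory Real Complex
open scoped ENNReal RealInnerProductSpace

set_option linter.unusedSectionVars false

noncomputable section

section nonstat2

variable {V : Type*} [NormedAddCommGroup V] [InnerProductSpace ℝ V] [FiniteDimensional ℝ V]
  [MeasurableSpace V] [BorelSpace V]

lemma rpow_split {s : ℝ} (hs : 0 ≤ s) {A B D : ℝ} (hA : 0 ≤ A) (hB : 0 ≤ B) (hD0 : 0 ≤ D)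
    (hD : D ≤ A + B) :
    (1 + D) ^ s ≤ (1 + A) ^ s * (1 + B) ^ ⌈s⌉₊ := by
  calc (1 + D) ^ s ≤ ((1 + A) * (1 + B)) ^ s := by
        apply Real.rpow_le_rpow (by positivity) _ hs
        nlinarith
    _ = (1 + A) ^ s * (1 + B) ^ s := Real.mul_rpow (by positivity) (by positivity)
    _ ≤ _ := by
        gcongr
        rw [← Real.rpow_natCast]
        exact Real.rpow_le_rpow_of_exponent_le (by linarith) (Nat.le_ceil s)

lemma Mu_deriv {r s : ℝ} (hs : 0 ≤ s) {F : V → ℝ} (hF : HH r F) (hrs : r ≤ s) (e : V) (k l : ℕ) :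
    Mu e s k (fun κ ξ η => ((κ ^ l * F (κ • (ξ + η)) : ℝ) : ℂ)) := by
  have hB : ∀ {r : ℝ} {F : V → ℝ} (_ : HH r F) (_ : r ≤ s) (l : ℕ),
      MuB s (fun κ (ξ η : V) => ((κ ^ l * F (κ • (ξ + η)) : ℝ) : ℂ)) := by
    intro r F hF hrs l
    have hFc := hF.1.continuous
    refine ⟨fun κ ξ => by fun_prop, ?_⟩
    obtain ⟨C, hC0, hC⟩ := hF.bound hrs hs
    refine ⟨⌈s⌉₊, C, hC0, fun κ hκ hκ1 ξ η => ?_⟩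
    rw [Complex.norm_real, norm_mul, norm_pow, Real.norm_of_nonneg hκ.le]
    have h1 : κ ^ l ≤ 1 := pow_le_one₀ hκ.le hκ1
    have h2 := hC (κ • (ξ + η))
    have h3 : (1 + ‖κ • (ξ + η)‖) ^ s ≤ (1 + ‖κ • ξ‖) ^ s * (1 + ‖η‖) ^ ⌈s⌉₊ := by
      apply rpow_split hs (norm_nonneg _) (norm_nonneg _) (norm_nonneg _)
      rw [smul_add]
      refine (norm_add_le _ _).trans ?_
      gcongr
      rw [norm_smul, Real.norm_of_nonneg hκ.le]
      nlinarith [norm_nonneg η]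
    calc κ ^ l * ‖F (κ • (ξ + η))‖ ≤ 1 * (C * ((1 + ‖κ • ξ‖) ^ s * (1 + ‖η‖) ^ ⌈s⌉₊)) := by
          gcongr
          exact h2.trans (by gcongr)
      _ = _ := by ring
  induction k generalizing r F l with
  | zero => exact hB hF hrs l
  | succ k ih =>
    refine ⟨hB hF hrs l, _, fun κ ξ η => ?_, ih (hF.dir e) (by linarith) (l + 1)⟩
    unfold HasLineDerivAt
    apply HasDerivAt.ofReal_comp
    have h1 : HasDerivAt (fun t : ℝ => κ • (ξ + (η + t • e))) (κ • e) 0 := by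
      have : HasDerivAt (fun t : ℝ => t • e) e 0 := by
        simpa using (hasDerivAt_id (0:ℝ)).smul_const e
      exact ((this.const_add η).const_add ξ).const_smul κ
    have h2 : HasFDerivAt F (fderiv ℝ F (κ • (ξ + η))) (κ • (ξ + (η + (0:ℝ) • e))) := by
      rw [zero_smul, add_zero]
      exact (hF.1.differentiable (by simp) _).hasFDerivAt
    have h3 := (h2.comp_hasDerivAt 0 h1).const_mul (κ ^ l)
    rw [map_smul, smul_eq_mul, ← mul_assoc, ← pow_succ] at h3
    exact h3

/-- the multiplier `q` -/
def qmul (M : V → ℝ) (e : V) : ℝ → V → V → ℂ := fun κ ξ η =>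
  ((κ * (fderiv ℝ M (κ • (ξ + η)) e - fderiv ℝ M (κ • ξ) e) : ℝ) : ℂ)

lemma Mu_q {m : ℝ} (hm : 2 ≤ m) {M : V → ℝ} (hM : HH m M) (e : V) (k : ℕ) :
    Mu e (m - 2) k (qmul M e) := by
  have hs : 0 ≤ m - 2 := by linarith
  have hp := hM.dir e
  set p := fun x => fderiv ℝ M x e with hpdef
  have hpc := hp.1.continuous
  have hB : MuB (m - 2) (qmul M e) := by
    refine ⟨fun κ ξ => ?_, ?_⟩
    · change Continuous (fun η => ((κ * (p (κ • (ξ + η)) - p (κ • ξ)) : ℝ) : ℂ))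
      fun_prop
    obtain ⟨C, hC0, hC⟩ := hp.fderiv.bound (s := m - 2) (by linarith) hs
    refine ⟨⌈m - 2⌉₊ + 1, C, hC0, fun κ hκ hκ1 ξ η => ?_⟩
    change ‖((κ * (p (κ • (ξ + η)) - p (κ • ξ)) : ℝ) : ℂ)‖ ≤ _
    rw [Complex.norm_real, norm_mul, Real.norm_of_nonneg hκ.le]
    have hκη : ‖κ • η‖ ≤ ‖η‖ := by
      rw [norm_smul, Real.norm_of_nonneg hκ.le]
      nlinarith [norm_nonneg η]
    have hb1 : ∀ z ∈ Metric.closedBall (0:V) (‖κ • ξ‖ + ‖η‖), ‖fderiv ℝ p z‖ ≤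
        C * ((1 + ‖κ • ξ‖) ^ (m - 2) * (1 + ‖η‖) ^ ⌈m - 2⌉₊) := by
      intro z hz
      refine (hC z).trans ?_
      gcongr
      apply rpow_split hs (norm_nonneg _) (norm_nonneg _) (norm_nonneg _)
      simpa using hz
    have h2 := (convex_closedBall (0:V) (‖κ • ξ‖ + ‖η‖)).norm_image_sub_le_of_norm_fderiv_le
      (f := p) (fun z _ => hp.1.differentiable (by simp) z) hb1
      (x := κ • ξ) (y := κ • (ξ + η)) (by simp) (by
        rw [mem_closedBall_zero_iff, smul_add]
        exact (norm_add_le _ _).trans (by gcongr))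
    have h3 : ‖κ • (ξ + η) - κ • ξ‖ ≤ 1 + ‖η‖ := by
      rw [smul_add, add_sub_cancel_left]; linarith
    calc _ ≤ 1 * (C * ((1 + ‖κ • ξ‖) ^ (m - 2) * (1 + ‖η‖) ^ ⌈m - 2⌉₊) * (1 + ‖η‖)) := by
          gcongr
          exact h2.trans (by gcongr)
      _ = _ := by ring
  cases k with
  | zero => exact hB
  | succ k =>
    refine ⟨hB, _, fun κ ξ η => ?_, Mu_deriv hs (hp.dir e) (by linarith) e k 2⟩
    unfold HasLineDerivAt
    apply HasDerivAt.ofReal_comp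
    have h1 : HasDerivAt (fun t : ℝ => κ • (ξ + (η + t • e))) (κ • e) 0 := by
      have : HasDerivAt (fun t : ℝ => t • e) e 0 := by
        simpa using (hasDerivAt_id (0:ℝ)).smul_const e
      exact ((this.const_add η).const_add ξ).const_smul κ
    have h2 : HasFDerivAt p (fderiv ℝ p (κ • (ξ + η))) (κ • (ξ + (η + (0:ℝ) • e))) := by
      rw [zero_smul, add_zero]
      exact (hp.1.differentiable (by simp) _).hasFDerivAt
    have h3 := ((h2.comp_hasDerivAt 0 h1).sub_const (p (κ • ξ))).const_mul κ
    rw [map_smul, smul_eq_mul, ← mul_assoc, ← pow_two] at h3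
    exact h3

/-- oscillatory integral -/
def osc (M : V → ℝ) (κ : ℝ) (x ξ : V) (a : V → ℂ) : ℂ :=
  ∫ η, ex (⟪x, η⟫ + M (κ • (ξ + η))) * a η

lemma SyB.integ {s : ℝ} {n : ℕ} {a : ℝ → V → V → ℂ} (ha : SyB s n a) :
    ∃ C : ℝ, 0 ≤ C ∧ ∀ κ : ℝ, 0 < κ → κ ≤ 1 → ∀ ξ, Integrable (a κ ξ) ∧
      ∫ η, ‖a κ ξ η‖ ≤ C * ((1 + ‖κ • ξ‖) ^ s) ^ n := by
  set P := Module.finrank ℝ V + 1 with hP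
  obtain ⟨C, hC0, hC⟩ := ha.2 P
  have hint : Integrable (fun η : V => (1 + ‖η‖) ^ (-(P:ℝ))) :=
    integrable_one_add_norm (by rw [hP]; push_cast; linarith)
  refine ⟨C * ∫ η : V, (1 + ‖η‖) ^ (-(P:ℝ)), by positivity, fun κ hκ hκ1 ξ => ?_⟩
  have hb : ∀ η, ‖a κ ξ η‖ ≤ C * ((1 + ‖κ • ξ‖) ^ s) ^ n * (1 + ‖η‖) ^ (-(P:ℝ)) := by
    intro η
    rw [Real.rpow_neg (by positivity), Real.rpow_natCast, ← div_eq_mul_inv,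
      le_div_iff₀ (by positivity)]
    exact hC κ hκ hκ1 ξ η
  have hi := hint.const_mul (C * ((1 + ‖κ • ξ‖) ^ s) ^ n)
  have hai : Integrable (a κ ξ) := by
    refine hi.mono' (ha.1 κ ξ).aestronglyMeasurable (Filter.Eventually.of_forall hb)
  refine ⟨hai, ?_⟩
  calc _ ≤ ∫ η, C * ((1 + ‖κ • ξ‖) ^ s) ^ n * (1 + ‖η‖) ^ (-(P:ℝ)) :=
        integral_mono hai.norm hi hb
    _ = _ := by rw [integral_const_mul]; ring

lemma norm_osc_le (M : V → ℝ) (κ : ℝ) (x ξ : V) (a : V → ℂ) :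
    ‖osc M κ x ξ a‖ ≤ ∫ η, ‖a η‖ := by
  refine (norm_integral_le_integral_norm _).trans (le_of_eq ?_)
  congr 1; ext η; rw [norm_mul, norm_ex, one_mul]

lemma ex_mul_integrable {a : V → ℂ} (ha : Integrable a) {φ : V → ℝ} (hφ : Measurable φ) :
    Integrable (fun η => ex (φ η) * a η) := by
  refine ha.bdd_mul (c := 1) ?_ (Filter.Eventually.of_forall fun η => by simp)
  exact (continuous_ex.measurable.comp hφ).aestronglyMeasurable

lemma osc_step {m : ℝ} (hm : 2 ≤ m) {M : V → ℝ} (hM : HH m M) (e : V) {n : ℕ}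
    {a a' : ℝ → V → V → ℂ} (ha : SyB (m - 2) n a) (ha' : SyB (m - 2) n a')
    (hd : ∀ κ ξ η, HasLineDerivAt ℝ (a κ ξ) (a' κ ξ η) η e) (κ : ℝ) (hκ : 0 < κ) (hκ1 : κ ≤ 1)
    (x ξ : V) :
    ((⟪x, e⟫ + κ * fderiv ℝ M (κ • ξ) e : ℝ) : ℂ) * osc M κ x ξ (a κ ξ) =
      osc M κ x ξ (fun η => -(2 * Real.pi * Complex.I)⁻¹ * a' κ ξ η +
        (-1) * (qmul M e κ ξ η * a κ ξ η)) := by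
  have hMc := hM.1.continuous
  set φ : V → ℝ := fun η => ⟪x, η⟫ + M (κ • (ξ + η)) with hφ
  have hφc : Continuous φ := by fun_prop
  set X : ℝ := ⟪x, e⟫ + κ * fderiv ℝ M (κ • ξ) e with hX
  set q := qmul M e κ ξ with hq
  have hqa : SyB (m - 2) (n + 1) (fun κ ξ η => qmul M e κ ξ η * a κ ξ η) :=
    SyB.mul (Mu_q hm hM e 0) ha
  obtain ⟨_, _, i1⟩ := ha.integ
  obtain ⟨_, _, i2⟩ := ha'.integ
  obtain ⟨_, _, i3⟩ := hqa.integ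
  have i1 := (i1 κ hκ hκ1 ξ).1
  have i2 := (i2 κ hκ hκ1 ξ).1
  have i3 := (i3 κ hκ hκ1 ξ).1
  have j1 := ex_mul_integrable i1 hφc.measurable
  have j2 := ex_mul_integrable i2 hφc.measurable
  have j3 := ex_mul_integrable i3 hφc.measurable
  have hder : ∀ η, HasLineDerivAt ℝ (fun η => ex (φ η))
      (2 * Real.pi * Complex.I * ((X : ℂ) + q η) * ex (φ η)) η e := by
    intro η
    unfold HasLineDerivAt
    have h0 : HasDerivAt (fun t : ℝ => t • e) e 0 := by
      simpa using (hasDerivAt_id (0:ℝ)).smul_const e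
    have h1 : HasDerivAt (fun t : ℝ => κ • (ξ + (η + t • e))) (κ • e) 0 :=
      ((h0.const_add η).const_add ξ).const_smul κ
    have h2 : HasFDerivAt M (fderiv ℝ M (κ • (ξ + η))) (κ • (ξ + (η + (0:ℝ) • e))) := by
      rw [zero_smul, add_zero]
      exact (hM.1.differentiable (by simp) _).hasFDerivAt
    have h3 := h2.comp_hasDerivAt 0 h1
    have h4 : HasDerivAt (fun t : ℝ => ⟪x, η + t • e⟫) ⟪x, e⟫ 0 := by
      simp only [inner_add_right, inner_smul_right]
      simpa using ((hasDerivAt_id (0:ℝ)).mul_const ⟪x, e⟫).const_add ⟪x, η⟫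
    have h5 := ex_hasDerivAt (h4.add h3)
    rw [map_smul, smul_eq_mul] at h5
    simp only [Pi.add_apply, Function.comp_apply, zero_smul, add_zero] at h5
    have e1 : 2 * Real.pi * Complex.I * ((X : ℂ) + q η) * ex (φ η) =
        2 * Real.pi * Complex.I * ((⟪x, e⟫ + κ * fderiv ℝ M (κ • (ξ + η)) e : ℝ) : ℂ) *
          ex (⟪x, η⟫ + M (κ • (ξ + η))) := by
      rw [hq, qmul, hX]
      push_cast
      ring
    rw [e1]
    exact h5
  have hibp := integral_bilinear_hasLineDerivAt_right_eq_neg_left_of_integrable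
    (μ := (volume : Measure V)) (f := fun η => ex (φ η))
    (f' := fun η => 2 * Real.pi * Complex.I * ((X : ℂ) + q η) * ex (φ η)) (g := a κ ξ)
    (g' := a' κ ξ) (v := e) (B := ContinuousLinearMap.mul ℝ ℂ) ?_ ?_ ?_ (fun η _ => hder η)
    (fun η _ => hd κ ξ η)
  · simp only [ContinuousLinearMap.mul_apply'] at hibp
    have e1 : ∫ η, 2 * Real.pi * Complex.I * ((X : ℂ) + q η) * ex (φ η) * a κ ξ η =
        2 * Real.pi * Complex.I * ((X : ℂ) * ∫ η, ex (φ η) * a κ ξ η) +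
        2 * Real.pi * Complex.I * ∫ η, ex (φ η) * (q η * a κ ξ η) := by
      rw [← integral_const_mul, ← integral_const_mul, ← integral_const_mul, ← integral_add]
      · congr 1; ext η; ring
      · exact (j1.const_mul _).const_mul _
      · exact j3.const_mul _
    rw [e1] at hibp
    have e2 : osc M κ x ξ (fun η => -(2 * Real.pi * Complex.I)⁻¹ * a' κ ξ η +
        (-1) * (q η * a κ ξ η)) = -(2 * Real.pi * Complex.I)⁻¹ * (∫ η, ex (φ η) * a' κ ξ η) +
        (-1) * ∫ η, ex (φ η) * (q η * a κ ξ η) := by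
      rw [osc, ← integral_const_mul, ← integral_const_mul, ← integral_add]
      · congr 1; ext η; ring
      · exact j2.const_mul _
      · exact j3.const_mul _
    rw [e2, hibp]
    change (X : ℂ) * (∫ η, ex (φ η) * a κ ξ η) = _
    have hpi : (2 * Real.pi * Complex.I : ℂ) ≠ 0 := by simp [Real.pi_ne_zero]
    field_simp
    ring
  · simp only [ContinuousLinearMap.mul_apply']
    have := ((j1.const_mul (X:ℂ)).add j3).const_mul (2 * Real.pi * Complex.I)
    refine this.congr (Filter.Eventually.of_forall fun η => ?_)
    simp only [Pi.add_apply]; ring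
  · exact j2
  · exact j1

lemma osc_decay {m : ℝ} (hm : 2 ≤ m) {M : V → ℝ} (hM : HH m M) (e : V) (N : ℕ) :
    ∀ (n : ℕ) (a : ℝ → V → V → ℂ), Sy e (m - 2) n N a → ∃ C : ℝ, 0 ≤ C ∧
      ∀ κ : ℝ, 0 < κ → κ ≤ 1 → ∀ x ξ : V,
      |⟪x, e⟫ + κ * fderiv ℝ M (κ • ξ) e| ^ N * ‖osc M κ x ξ (a κ ξ)‖ ≤
        C * ((1 + ‖κ • ξ‖) ^ (m - 2)) ^ (n + N) := by
  induction N with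
  | zero =>
    intro n a ha
    obtain ⟨C, hC0, hC⟩ := ha.base.integ
    refine ⟨C, hC0, fun κ hκ hκ1 x ξ => ?_⟩
    rw [pow_zero, one_mul]
    exact (norm_osc_le _ _ _ _ _).trans (hC κ hκ hκ1 ξ).2
  | succ N ih =>
    intro n a ha
    have had := ha.down
    obtain ⟨h1, a', h2, h3⟩ := ha
    have hs : 0 ≤ m - 2 := by linarith
    have hT : Sy e (m - 2) (n + 1) N (fun κ ξ η => -(2 * Real.pi * Complex.I)⁻¹ * a' κ ξ η +
        (-1) * (qmul M e κ ξ η * a κ ξ η)) := by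
      have hqa := Sy.mul (Mu_q hm hM e N) had
      have h0 := hqa.lin hqa (-2)
      have := (h3.up hs).lin h0 (-(2 * Real.pi * Complex.I)⁻¹)
      convert this using 4
      ring
    obtain ⟨C, hC0, hC⟩ := ih _ _ hT
    refine ⟨C, hC0, fun κ hκ hκ1 x ξ => ?_⟩
    have h4 := hC κ hκ hκ1 x ξ
    rw [← osc_step hm hM e h1 h3.base h2 κ hκ hκ1 x ξ, norm_mul, Complex.norm_real,
      Real.norm_eq_abs] at h4
    calc _ = _ := by rw [pow_succ, mul_assoc]
      _ ≤ _ := h4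
      _ = _ := by congr 2; ring

open LineDeriv in
lemma Sy_schwartz (e : V) {s : ℝ} (ψ : SchwartzMap V ℂ) (k : ℕ) :
    Sy e s 0 k (fun _ _ η => ψ η) := by
  have hB : ∀ ψ : SchwartzMap V ℂ, SyB s 0 (fun _ _ η => ψ η) := by
    intro ψ
    refine ⟨fun _ _ => ψ.continuous, fun P => ?_⟩
    have h := SchwartzMap.one_add_le_sup_seminorm_apply (𝕜 := ℝ) (m := (P, 0)) (k := P) (n := 0)
      le_rfl le_rfl ψ
    refine ⟨2 ^ P * ((Finset.Iic (P, 0)).sup fun m => SchwartzMap.seminorm ℝ m.1 m.2) ψ,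
      mul_nonneg (by positivity) (apply_nonneg _ _), fun κ _ _ ξ η => ?_⟩
    have := h η
    rw [norm_iteratedFDeriv_zero, mul_comm] at this
    rw [pow_zero, mul_one]
    exact this
  induction k generalizing ψ with
  | zero => exact hB ψ
  | succ k ih =>
    refine ⟨hB ψ, _, fun κ ξ η => ?_, ih (∂_{e} ψ)⟩
    rw [SchwartzMap.lineDerivOp_apply_eq_fderiv]
    exact ψ.differentiableAt.hasFDerivAt.hasLineDerivAt e

end nonstat2

open MeasureTheory Real Complex
open scoped ENNReal RealInnerProductSpace

set_option linter.unusedSectionVars false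

noncomputable section

section kern

variable {V : Type*} [NormedAddCommGroup V] [InnerProductSpace ℝ V] [FiniteDimensional ℝ V]
  [MeasurableSpace V] [BorelSpace V]

lemma norm_le_sum_basis (L : V →L[ℝ] ℝ) :
    ‖L‖ ≤ ∑ i, |L (stdOrthonormalBasis ℝ V i)| := by
  refine L.opNorm_le_bound (by positivity) fun v => ?_
  have h1 : v = ∑ i, ⟪stdOrthonormalBasis ℝ V i, v⟫ • stdOrthonormalBasis ℝ V i :=
    ((stdOrthonormalBasis ℝ V).sum_repr' v).symm
  calc ‖L v‖ = ‖∑ i, ⟪stdOrthonormalBasis ℝ V i, v⟫ * L (stdOrthonormalBasis ℝ V i)‖ := by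
        conv_lhs => rw [h1]
        simp
    _ ≤ ∑ i, ‖⟪stdOrthonormalBasis ℝ V i, v⟫ * L (stdOrthonormalBasis ℝ V i)‖ := norm_sum_le _ _
    _ ≤ ∑ i, |L (stdOrthonormalBasis ℝ V i)| * ‖v‖ := by
        refine Finset.sum_le_sum fun i _ => ?_
        rw [norm_mul, mul_comm]
        refine mul_le_mul_of_nonneg_left ?_ (by positivity)
        refine (norm_inner_le_norm _ _).trans ?_
        simp
    _ = _ := by rw [Finset.sum_mul]

lemma osc_final {m : ℝ} (hm : 2 ≤ m) {M : V → ℝ} (hM : HH m M) (ψ : SchwartzMap V ℂ) (k : ℕ) :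
    ∃ C : ℝ, 0 ≤ C ∧ ∀ κ : ℝ, 0 < κ → κ ≤ 1 → ∀ x ξ : V,
      ‖osc M κ x ξ ψ‖ ≤ C * (1 + ‖innerSL ℝ x + κ • fderiv ℝ M (κ • ξ)‖ /
        (1 + ‖κ • ξ‖) ^ (m - 2)) ^ (-((k + 1 : ℕ) : ℝ)) := by
  set n := Module.finrank ℝ V
  choose C hC0 hC using fun i : Fin n =>
    osc_decay hm hM (stdOrthonormalBasis ℝ V i) (k + 1) 0 _
      (Sy_schwartz (stdOrthonormalBasis ℝ V i) ψ (k + 1))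
  set I := ∫ η, ‖ψ η‖
  have hI : 0 ≤ I := by positivity
  refine ⟨2 ^ k * (I + (n : ℝ) ^ k * ∑ i, C i),
    mul_nonneg (by positivity) (add_nonneg hI (mul_nonneg (by positivity)
      (Finset.sum_nonneg fun i _ => hC0 i))), fun κ hκ hκ1 x ξ => ?_⟩
  set L := innerSL ℝ x + κ • fderiv ℝ M (κ • ξ) with hL
  set Q := (1 + ‖κ • ξ‖) ^ (m - 2) with hQ
  have hQ0 : 0 < Q := by positivity
  have hLe : ∀ i, L (stdOrthonormalBasis ℝ V i) = ⟪x, stdOrthonormalBasis ℝ V i⟫ +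
      κ * fderiv ℝ M (κ • ξ) (stdOrthonormalBasis ℝ V i) := fun i => by simp [hL]
  set O := ‖osc M κ x ξ ψ‖ with hO
  have hO0 : 0 ≤ O := norm_nonneg _
  have hOI : O ≤ I := norm_osc_le _ _ _ _ _
  rw [Real.rpow_neg (by positivity), Real.rpow_natCast, ← div_eq_mul_inv,
    le_div_iff₀ (by positivity)]
  have h1 : (1 + ‖L‖ / Q) ^ (k + 1) ≤ 2 ^ k * (1 + (n:ℝ) ^ k *
      ∑ i, (|L (stdOrthonormalBasis ℝ V i)| / Q) ^ (k + 1)) := by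
    calc (1 + ‖L‖ / Q) ^ (k + 1) ≤
        (1 + ∑ i, |L (stdOrthonormalBasis ℝ V i)| / Q) ^ (k + 1) := by
          gcongr
          rw [← Finset.sum_div]
          gcongr
          exact norm_le_sum_basis L
      _ ≤ 2 ^ k * (1 ^ (k + 1) + (∑ i, |L (stdOrthonormalBasis ℝ V i)| / Q) ^ (k + 1)) := by
          have := add_pow_le (zero_le_one' ℝ) (Finset.sum_nonneg (s := Finset.univ) fun i _ =>
            (by positivity : 0 ≤ |L (stdOrthonormalBasis ℝ V i)| / Q)) (k + 1)
          simpa using this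
      _ ≤ _ := by
          rw [one_pow]
          gcongr
          have := pow_sum_le_card_mul_sum_pow (s := Finset.univ) (fun i _ =>
            (by positivity : 0 ≤ |L (stdOrthonormalBasis ℝ V i)| / Q)) k
          simpa using this
  calc O * (1 + ‖L‖ / Q) ^ (k + 1) ≤ O * (2 ^ k * (1 + (n:ℝ) ^ k *
      ∑ i, (|L (stdOrthonormalBasis ℝ V i)| / Q) ^ (k + 1))) := by gcongr
    _ = 2 ^ k * (O + (n:ℝ) ^ k * ∑ i, |L (stdOrthonormalBasis ℝ V i)| ^ (k + 1) * O /
          Q ^ (k + 1)) := by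
        simp only [div_pow, mul_add, mul_one, Finset.mul_sum]
        congr 1
        · ring
        · exact Finset.sum_congr rfl fun i _ => by ring
    _ ≤ 2 ^ k * (I + (n : ℝ) ^ k * ∑ i, C i) := by
        gcongr with i
        rw [div_le_iff₀ (by positivity), hLe]
        have := hC i κ hκ hκ1 x ξ
        rw [zero_add] at this
        exact this

/-- the phase with the singularity at the origin removed -/
def cutPhase (μ : V → ℝ) (x : V) : ℝ :=
  (1 - (⟨1/2, 1, by norm_num, by norm_num⟩ : ContDiffBump (0 : V)) x) * μ x

lemma cutPhase_eq {μ : V → ℝ} {x : V} (hx : 1 ≤ ‖x‖) : cutPhase μ x = μ x := by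
  rw [cutPhase, ContDiffBump.zero_of_le_dist _ (by simpa using hx)]; ring

lemma cutPhase_HH {m : ℝ} {μ : V → ℝ}
    (hsmooth : ContDiffOn ℝ (⊤ : ℕ∞) μ {x | x ≠ 0})
    (hhom : ∀ c : ℝ, 0 < c → ∀ x : V, x ≠ 0 → μ (c • x) = c ^ m * μ x) : HH m (cutPhase μ) := by
  constructor
  · rw [contDiff_iff_contDiffAt]
    intro x
    by_cases hx : x = 0
    · subst hx
      have : cutPhase μ =ᶠ[nhds 0] fun _ => 0 := by
        filter_upwards [Metric.closedBall_mem_nhds (0:V) (by norm_num : (0:ℝ) < 1/2)] with y hy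
        rw [cutPhase, ContDiffBump.one_of_mem_closedBall _ hy]; ring
      exact contDiffAt_const.congr_of_eventuallyEq this
    · have h1 : ContDiffAt ℝ (⊤ : ℕ∞) μ x := (hsmooth x hx).contDiffAt (isOpen_ne.mem_nhds hx)
      exact (contDiffAt_const.sub (ContDiffBump.contDiffAt _)).mul h1
  · intro c hc x hx
    have hx0 : x ≠ 0 := norm_pos_iff.1 (by linarith)
    rw [cutPhase_eq hx.le, cutPhase_eq, hhom c (by linarith) x hx0, smul_eq_mul]
    rw [norm_smul, Real.norm_of_nonneg (by linarith)]
    nlinarith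

lemma cutPhase_fderiv {μ : V → ℝ} {x : V} (hx : 1 < ‖x‖) :
    fderiv ℝ (cutPhase μ) x = fderiv ℝ μ x := by
  apply Filter.EventuallyEq.fderiv_eq
  filter_upwards [(isOpen_lt continuous_const continuous_norm).mem_nhds hx] with y hy
  exact cutPhase_eq (le_of_lt hy)

lemma meas_phase {μ : V → ℝ} (hsmooth : ContDiffOn ℝ (⊤ : ℕ∞) μ {x | x ≠ 0}) : Measurable μ :=
  measurable_of_continuousOn_compl_singleton 0 hsmooth.continuousOn

lemma kernel_bound (m : ℝ) (hm : 2 ≤ m) (μ : V → ℝ)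
    (hsmooth : ContDiffOn ℝ (⊤ : ℕ∞) μ {x | x ≠ 0})
    (hhom : ∀ c : ℝ, 0 < c → ∀ x : V, x ≠ 0 → μ (c • x) = c ^ m * μ x)
    (hhess : ∀ x : V, ‖x‖ = 1 → Function.Bijective ⇑(fderiv ℝ (fderiv ℝ μ) x))
    (ψ : SchwartzMap V ℂ) :
    ∃ C : ℝ≥0∞, C ≠ ⊤ ∧ ∀ κ : ℝ, 0 < κ → κ ≤ 1 → ∀ x : V,
      ∫⁻ ξ, ‖osc μ κ x ξ ψ‖ₑ ≤ C * ENNReal.ofReal (((κ ^ 2) ^ Module.finrank ℝ V)⁻¹) := by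
  have hH := cutPhase_HH hsmooth hhom
  set n := Module.finrank ℝ V with hn
  obtain ⟨C1, hC10, hC1⟩ := osc_final hm hH ψ n
  obtain ⟨C2, hC2t, hC2⟩ := cone_integral m hm μ hsmooth hhom hhess ((n + 1 : ℕ) : ℝ)
    (by push_cast; linarith)
  set I : ℝ≥0∞ := ∫⁻ η, ‖ψ η‖ₑ with hI
  have hIt : I ≠ ⊤ := ψ.integrable.hasFiniteIntegral.ne
  set B : ℝ≥0∞ := volume (Metric.closedBall (0:V) 1) with hB
  have hBt : B ≠ ⊤ := measure_closedBall_lt_top.ne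
  refine ⟨2 * I * B + I * B + ENNReal.ofReal C1 * C2, by
    refine ENNReal.add_ne_top.2 ⟨ENNReal.add_ne_top.2 ⟨?_, ?_⟩, ?_⟩ <;>
    repeat' first | exact hIt | exact hBt | exact hC2t | apply ENNReal.mul_ne_top
    all_goals simp, ?_⟩
  intro κ hκ hκ1 x
  set K := ENNReal.ofReal (((κ ^ 2) ^ n)⁻¹) with hK
  have hμm := meas_phase hsmooth
  have hμ1m : Measurable (cutPhase μ) := hH.1.continuous.measurable
  have hmeasF : Measurable fun ζ : V =>
      (Metric.closedBall (0:V) 1).indicator (fun _ => (1:ℝ≥0∞)) ζ :=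
    measurable_const.indicator measurableSet_closedBall
  have hball : ∫⁻ ξ, (Metric.closedBall (0:V) 1).indicator (fun _ => (1:ℝ≥0∞)) (κ • ξ) ≤ B * K := by
    rw [lint_smul _ hmeasF κ hκ, lintegral_indicator measurableSet_closedBall, setLIntegral_one,
      mul_comm]
    gcongr
    rw [hK]
    gcongr
    rw [pow_two]; nlinarith
  have hjm : Measurable fun p : V × V => 2 * (Metric.closedBall (0:V) 1).indicator
      (fun _ => (1:ℝ≥0∞)) (κ • (p.1 + p.2)) * ‖ψ p.2‖ₑ :=
    ((hmeasF.comp (by fun_prop : Measurable fun p : V × V => κ • (p.1 + p.2))).const_mul 2).mul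
      (ψ.continuous.measurable.comp measurable_snd).enorm
  have hdiff : ∀ ξ, ‖osc μ κ x ξ ψ‖ₑ ≤ ‖osc (cutPhase μ) κ x ξ ψ‖ₑ +
      ∫⁻ η, 2 * (Metric.closedBall (0:V) 1).indicator (fun _ => (1:ℝ≥0∞)) (κ • (ξ + η)) *
        ‖ψ η‖ₑ := by
    intro ξ
    have i1 : Integrable (fun η => ex (⟪x, η⟫ + μ (κ • (ξ + η))) * ψ η) :=
      ex_mul_integrable ψ.integrable (by fun_prop)
    have i2 : Integrable (fun η => ex (⟪x, η⟫ + cutPhase μ (κ • (ξ + η))) * ψ η) :=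
      ex_mul_integrable ψ.integrable (by fun_prop)
    have e1 : osc μ κ x ξ ψ = osc (cutPhase μ) κ x ξ ψ + ∫ η,
        (ex (⟪x, η⟫ + μ (κ • (ξ + η))) * ψ η - ex (⟪x, η⟫ + cutPhase μ (κ • (ξ + η))) * ψ η) := by
      rw [integral_sub i1 i2]; simp only [osc]; ring
    rw [e1]
    refine (enorm_add_le _ _).trans ?_
    gcongr
    refine (enorm_integral_le_lintegral_enorm _).trans (lintegral_mono fun η => ?_)
    simp only
    rw [← sub_mul, enorm_mul]
    gcongr
    by_cases hc : ‖κ • (ξ + η)‖ ≤ 1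
    · rw [Set.indicator_of_mem (by simpa using hc), mul_one]
      refine (enorm_sub_le).trans ?_
      rw [← ofReal_norm, ← ofReal_norm, norm_ex, norm_ex]
      simp [one_add_one_eq_two]
    · push Not at hc
      rw [cutPhase_eq hc.le]; simp
  have hbig : ∫⁻ ξ, ‖osc (cutPhase μ) κ x ξ ψ‖ₑ ≤ I * B * K + ENNReal.ofReal C1 * C2 * K := by
    have hp : ∀ ξ, ‖osc (cutPhase μ) κ x ξ ψ‖ₑ ≤
        I * (Metric.closedBall (0:V) 1).indicator (fun _ => (1:ℝ≥0∞)) (κ • ξ) +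
        ({ξ : V | 1 < ‖κ • ξ‖}.indicator (fun ξ => ENNReal.ofReal C1 *
          ENNReal.ofReal ((1 + ‖innerSL ℝ x + κ • fderiv ℝ μ (κ • ξ)‖ /
        (1 + ‖κ • ξ‖) ^ (m - 2)) ^ (-((n + 1 : ℕ) : ℝ)))) ξ) := by
      intro ξ
      by_cases hc : ‖κ • ξ‖ ≤ 1
      · rw [Set.indicator_of_mem (by simpa using hc), mul_one]
        refine le_trans ?_ le_self_add
        refine (enorm_integral_le_lintegral_enorm _).trans (lintegral_mono fun η => ?_)
        rw [enorm_mul, ← ofReal_norm, norm_ex]; simp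
      · push Not at hc
        refine le_trans ?_ le_add_self
        rw [Set.indicator_of_mem (by exact hc), ← ofReal_norm, ← ENNReal.ofReal_mul hC10]
        have := hC1 κ hκ hκ1 x ξ
        rw [cutPhase_fderiv hc] at this
        exact ENNReal.ofReal_le_ofReal this
    refine (lintegral_mono hp).trans ?_
    rw [lintegral_add_left (by fun_prop), lintegral_const_mul _ (by fun_prop),
      lintegral_indicator (measurableSet_lt measurable_const (by fun_prop)),
      lintegral_const_mul' _ _ ENNReal.ofReal_ne_top, mul_assoc, mul_assoc]
    gcongr
    exact hC2 κ hκ hκ1 _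
  calc ∫⁻ ξ, ‖osc μ κ x ξ ψ‖ₑ ≤ ∫⁻ ξ, (‖osc (cutPhase μ) κ x ξ ψ‖ₑ +
      ∫⁻ η, 2 * (Metric.closedBall (0:V) 1).indicator (fun _ => (1:ℝ≥0∞)) (κ • (ξ + η)) *
        ‖ψ η‖ₑ) := lintegral_mono hdiff
    _ = (∫⁻ ξ, ‖osc (cutPhase μ) κ x ξ ψ‖ₑ) + ∫⁻ ξ, ∫⁻ η, 2 *
        (Metric.closedBall (0:V) 1).indicator (fun _ => (1:ℝ≥0∞)) (κ • (ξ + η)) * ‖ψ η‖ₑ := by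
        apply lintegral_add_right
        apply Measurable.lintegral_prod_right'
          (f := fun p : V × V => 2 * (Metric.closedBall (0:V) 1).indicator
            (fun _ => (1:ℝ≥0∞)) (κ • (p.1 + p.2)) * ‖ψ p.2‖ₑ)
        exact hjm
    _ ≤ (I * B * K + ENNReal.ofReal C1 * C2 * K) + 2 * I * B * K := by
        gcongr
        rw [lintegral_lintegral_swap]
        · have : ∀ η : V, ∫⁻ ξ, 2 * (Metric.closedBall (0:V) 1).indicator
              (fun _ => (1:ℝ≥0∞)) (κ • (ξ + η)) * ‖ψ η‖ₑ ≤ 2 * (B * K) * ‖ψ η‖ₑ := by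
            intro η
            rw [lintegral_mul_const _ (by fun_prop), lintegral_const_mul _ (by fun_prop)]
            gcongr
            rw [lintegral_add_right_eq_self (fun ξ => (Metric.closedBall (0:V) 1).indicator
              (fun _ => (1:ℝ≥0∞)) (κ • ξ))]
            exact hball
          refine (lintegral_mono this).trans (le_of_eq ?_)
          rw [lintegral_const_mul _ (by have := ψ.continuous; fun_prop)]
          ring
        · exact hjm.aemeasurable
    _ = _ := by ring

end kern

open MeasureTheory Real Complex
open scoped ENNReal RealInnerProductSpace

set_option linter.unusedSectionVars false

noncomputable section

lemma ex_hasTemperateGrowth : Function.HasTemperateGrowth ex := by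
  have hd : ∀ t, HasDerivAt ex (2 * Real.pi * Complex.I * ex t) t := fun t => by
    simpa using ex_hasDerivAt (hasDerivAt_id t)
  have hit : ∀ n : ℕ, iteratedDeriv n ex = fun t => (2 * Real.pi * Complex.I) ^ n * ex t := by
    intro n
    induction n with
    | zero => ext t; simp
    | succ n ih =>
      rw [iteratedDeriv_succ, ih]
      ext t
      rw [((hd t).const_mul _).deriv]; ring
  refine ⟨?_, fun n => ⟨0, ‖(2 * Real.pi * Complex.I) ^ n‖, fun t => ?_⟩⟩
  · unfold ex
    have h1 : ContDiff ℝ (⊤ : ℕ∞) (fun r : ℝ => ((2 * Real.pi * r : ℝ) : ℂ)) :=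
      Complex.ofRealCLM.contDiff.comp (contDiff_const.mul contDiff_id)
    exact (h1.mul contDiff_const).cexp
  · rw [norm_iteratedFDeriv_eq_norm_iteratedDeriv, hit, norm_mul, norm_ex]; simp

lemma ex_neg (a : ℝ) : ex (-a) = Complex.exp (-(((2 * Real.pi * a : ℝ) : ℂ) * Complex.I)) := by
  rw [ex]; congr 1; push_cast; ring

section test

variable {V : Type*} [NormedAddCommGroup V] [InnerProductSpace ℝ V] [FiniteDimensional ℝ V]
  [MeasurableSpace V] [BorelSpace V]

/-- conjugate of a Schwartz function -/
def conjS (g : SchwartzMap V ℂ) : SchwartzMap V ℂ :=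
  SchwartzMap.postcompCLM (𝕜 := ℝ) (Complex.conjCLE : ℂ →L[ℝ] ℂ) g

@[simp] lemma conjS_apply (g : SchwartzMap V ℂ) (x : V) : conjS g x = (starRingEnd ℂ) (g x) := by
  simp [conjS]

open FourierTransform in
/-- inverse Fourier transform of the conjugate window -/
def psi (g : SchwartzMap V ℂ) : SchwartzMap V ℂ := 𝓕⁻ (conjS g)

lemma psi_apply (g : SchwartzMap V ℂ) (η : V) :
    psi g η = ∫ y, ex ⟪η, y⟫ * (starRingEnd ℂ) (g y) := by
  rw [psi, SchwartzMap.fourierInv_coe, Real.fourierInv_eq']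
  congr 1; ext y
  rw [real_inner_comm, conjS_apply]; rfl

/-- the time-frequency shift of the conjugate window -/
def testfn (g : SchwartzMap V ℂ) (x ξ : V) : SchwartzMap V ℂ :=
  SchwartzMap.smulLeftCLM ℂ (fun y => ex (-⟪ξ, y⟫)) (SchwartzMap.compSubConstCLM ℂ x (conjS g))

lemma testfn_apply (g : SchwartzMap V ℂ) (x ξ y : V) :
    testfn g x ξ y = ex (-⟪ξ, y⟫) * (starRingEnd ℂ) (g (y - x)) := by
  rw [testfn, SchwartzMap.smulLeftCLM_apply_apply, SchwartzMap.compSubConstCLM_apply,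
    conjS_apply, smul_eq_mul]
  have h1 : Function.HasTemperateGrowth (fun y : V => -⟪ξ, y⟫) :=
    (Function.hasTemperateGrowth_inner_right ξ).neg
  exact ex_hasTemperateGrowth.comp h1

/-- `F` is the inverse Fourier transform of `e^{2π i t μ}` -/
def IsKer (μ : V → ℝ) (t : ℝ) (F : V → ℂ) : Prop :=
  Continuous F ∧ (∃ M : ℝ, ∀ x, ‖F x‖ ≤ M) ∧ ∀ φ : SchwartzMap V ℂ,
    ∫ x, F x * φ x = ∫ ξ, ex (t * μ ξ) * ∫ x, ex ⟪ξ, x⟫ * φ x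

lemma ae_ne_zero' [Nontrivial V] : ∀ᵐ x : V, x ≠ 0 := by
  rw [ae_iff]; simp

end test

lemma gaborT_eq (d : ℕ) (g : SchwartzMap (EuclideanSpace ℝ (Fin d)) ℂ)
    (v : EuclideanSpace ℝ (Fin d) → ℂ) (x ξ : EuclideanSpace ℝ (Fin d)) :
    gaborT d g v x ξ = ∫ y, v y * testfn g x ξ y := by
  rw [gaborT]; congr 1; ext y
  rw [testfn_apply, ex_neg]; ring

lemma gaborT_kernel (d : ℕ) (hd : 1 ≤ d) (m : ℝ)
    (μ : EuclideanSpace ℝ (Fin d) → ℝ)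
    (hhom : ∀ c : ℝ, 0 < c → ∀ x : EuclideanSpace ℝ (Fin d), x ≠ 0 →
      μ (c • x) = c ^ m * μ x)
    (g : SchwartzMap (EuclideanSpace ℝ (Fin d)) ℂ) (F : EuclideanSpace ℝ (Fin d) → ℂ)
    (κ : ℝ) (hκ : 0 < κ) (hF : IsKer μ (κ ^ m) F) (x ξ : EuclideanSpace ℝ (Fin d)) :
    gaborT d g F x ξ = osc μ κ x ξ (psi g) := by
  have : Nonempty (Fin d) := ⟨⟨0, hd⟩⟩
  rw [gaborT_eq, hF.2.2]
  have h1 : ∀ ζ, ∫ y, ex ⟪ζ, y⟫ * testfn g x ξ y = ex ⟪x, ζ - ξ⟫ * psi g (ζ - ξ) := by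
    intro ζ
    rw [psi_apply, ← integral_const_mul,
      ← integral_sub_right_eq_self (fun y => ex ⟪x, ζ - ξ⟫ * (ex ⟪ζ - ξ, y⟫ * _)) x]
    congr 1; ext y
    rw [testfn_apply, ← mul_assoc, ← mul_assoc, ← ex_add, ← ex_add]
    congr 2
    rw [inner_sub_left, inner_sub_right, inner_sub_right, inner_sub_right]
    rw [real_inner_comm x ζ, real_inner_comm x ξ]; ring
  simp_rw [h1]
  rw [osc, ← integral_add_right_eq_self (fun ζ => ex (κ ^ m * μ ζ) * _) ξ]
  refine integral_congr_ae ?_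
  have h2 : ∀ᵐ η : EuclideanSpace ℝ (Fin d), η + ξ ≠ 0 := by
    have := (measurePreserving_add_right (volume : Measure (EuclideanSpace ℝ (Fin d)))
      ξ).quasiMeasurePreserving.ae ae_ne_zero'
    exact this
  filter_upwards [h2] with η hη
  rw [add_sub_cancel_right, add_comm ξ η, hhom κ hκ _ hη, ex_add]; ring

lemma W_kernel_unit (d : ℕ) (hd : 1 ≤ d) (m : ℝ) (hm : 2 ≤ m)
    (μ : EuclideanSpace ℝ (Fin d) → ℝ)
    (hsmooth : ContDiffOn ℝ (⊤ : ℕ∞) μ {x | x ≠ 0})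
    (hhom : ∀ c : ℝ, 0 < c → ∀ x : EuclideanSpace ℝ (Fin d), x ≠ 0 →
      μ (c • x) = c ^ m * μ x)
    (hhess : ∀ x : EuclideanSpace ℝ (Fin d), ‖x‖ = 1 →
      Function.Bijective ⇑(fderiv ℝ (fderiv ℝ μ) x))
    (g : SchwartzMap (EuclideanSpace ℝ (Fin d)) ℂ)
    (EE : ℝ → EuclideanSpace ℝ (Fin d) → ℂ) (hEE : ∀ t : ℝ, 0 < t → IsKer μ t (EE t)) :
    ∃ C : ℝ≥0∞, C ≠ ⊤ ∧ ∀ t : ℝ, 0 < t → t ≤ 1 → ∀ x,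
      ∫⁻ ξ, ‖gaborT d g (EE t) x ξ‖ₑ ≤ C * ENNReal.ofReal (t ^ (-(2 * d / m))) := by
  obtain ⟨C, hCt, hC⟩ := kernel_bound m hm μ hsmooth hhom hhess (psi g)
  refine ⟨C, hCt, fun t ht ht1 x => ?_⟩
  set κ := t ^ (1 / m) with hκ
  have hm0 : m ≠ 0 := by linarith
  have hκ0 : 0 < κ := by positivity
  have hκ1 : κ ≤ 1 := Real.rpow_le_one ht.le ht1 (by positivity)
  have hκm : κ ^ m = t := by
    rw [hκ, ← Real.rpow_mul ht.le, one_div, inv_mul_cancel₀ hm0, Real.rpow_one]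
  have h1 := hC κ hκ0 hκ1 x
  have h2 : ((κ ^ 2) ^ Module.finrank ℝ (EuclideanSpace ℝ (Fin d)))⁻¹ = t ^ (-(2 * d / m)) := by
    rw [finrank_euclideanSpace_fin, ← pow_mul, Real.rpow_neg ht.le, hκ, ← Real.rpow_natCast,
      ← Real.rpow_mul ht.le]
    congr 2; push_cast; field_simp
  rw [h2] at h1
  refine le_trans (le_of_eq ?_) h1
  congr 1; ext ξ
  rw [gaborT_kernel d hd m μ hhom g (EE t) κ hκ0 (by rw [hκm]; exact hEE t ht)]

lemma W_kernel (d : ℕ) (hd : 1 ≤ d) (m : ℝ) (hm : 2 ≤ m)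
    (μ : EuclideanSpace ℝ (Fin d) → ℝ)
    (hsmooth : ContDiffOn ℝ (⊤ : ℕ∞) μ {x | x ≠ 0})
    (hhom : ∀ c : ℝ, 0 < c → ∀ x : EuclideanSpace ℝ (Fin d), x ≠ 0 →
      μ (c • x) = c ^ m * μ x)
    (hhess : ∀ x : EuclideanSpace ℝ (Fin d), ‖x‖ = 1 →
      Function.Bijective ⇑(fderiv ℝ (fderiv ℝ μ) x))
    (g : SchwartzMap (EuclideanSpace ℝ (Fin d)) ℂ)
    (EE : ℝ → EuclideanSpace ℝ (Fin d) → ℂ) (hEE : ∀ t : ℝ, 0 < t → IsKer μ t (EE t))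
    (T : ℝ) (hT : 0 < T) :
    ∃ C : ℝ≥0∞, C ≠ ⊤ ∧ ∀ t : ℝ, 0 < t → t ≤ T → ∀ x,
      ∫⁻ ξ, ‖gaborT d g (EE t) x ξ‖ₑ ≤ C * ENNReal.ofReal (t ^ (-(2 * d / m))) := by
  obtain ⟨C, hCt, hC⟩ := W_kernel_unit d hd m hm (fun x => T • μ x) (hsmooth.const_smul T)
    (fun c hc x hx => by simp only [smul_eq_mul]; rw [hhom c hc x hx]; ring)
    (fun x hx => by
      have e1 : fderiv ℝ (fun x => T • μ x) = fun x => T • fderiv ℝ μ x := by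
        exact fderiv_const_smul_field (𝕜 := ℝ) (f := μ) T
      have e2 : fderiv ℝ (fun x => T • fderiv ℝ μ x) x = T • fderiv ℝ (fderiv ℝ μ) x :=
        congrFun (fderiv_const_smul_field (𝕜 := ℝ) (f := fderiv ℝ μ) T) x
      rw [e1, e2]
      exact (MulAction.bijective (Units.mk0 T hT.ne')).comp (hhess x hx))
    g (fun t => EE (T * t)) (fun t ht => by
      have := hEE (T * t) (by positivity)
      refine ⟨this.1, this.2.1, fun φ => (this.2.2 φ).trans ?_⟩
      congr 1; ext ξ; congr 2; simp only [smul_eq_mul]; ring)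
  refine ⟨C * ENNReal.ofReal ((T⁻¹) ^ (-(2 * d / m))), ENNReal.mul_ne_top hCt (by simp),
    fun t ht htT x => ?_⟩
  have := hC (T⁻¹ * t) (by positivity) (by rw [inv_mul_le_iff₀ hT]; linarith) x
  rw [mul_inv_cancel_left₀ hT.ne', Real.mul_rpow (by positivity) ht.le,
    ENNReal.ofReal_mul (by positivity), ← mul_assoc] at this
  exact this

open MeasureTheory Real Complex
open scoped ENNReal RealInnerProductSpace

set_option linter.unusedSectionVars false

noncomputable section

section ker

variable {V : Type*} [NormedAddCommGroup V] [InnerProductSpace ℝ V] [FiniteDimensional ℝ V]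
  [MeasurableSpace V] [BorelSpace V]

lemma ker_unique {μ : V → ℝ} {t : ℝ} {F G : V → ℂ} (hF : IsKer μ t F) (hG : IsKer μ t G) :
    F = G := by
  have hc : Continuous (fun x => F x - G x) := hF.1.sub hG.1
  have key : ∀ᵐ x : V, F x - G x = 0 := by
    refine ae_eq_zero_of_integral_contDiff_smul_eq_zero hc.locallyIntegrable ?_
    intro q hq hqc
    have hq' : ContDiff ℝ (⊤ : ℕ∞) (fun x => ((q x : ℝ) : ℂ)) :=
      Complex.ofRealCLM.contDiff.comp hq
    have hqc' : HasCompactSupport (fun x => ((q x : ℝ) : ℂ)) :=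
      hqc.comp_left (g := Complex.ofReal) (by simp)
    set φ : SchwartzMap V ℂ := hqc'.toSchwartzMap hq' with hφ
    have hφa : ∀ x, φ x = ((q x : ℝ) : ℂ) := fun x => rfl
    obtain ⟨M, hM⟩ := hF.2.1
    obtain ⟨M', hM'⟩ := hG.2.1
    have i1 : Integrable (fun x => F x * φ x) :=
      φ.integrable.bdd_mul (c := M) hF.1.aestronglyMeasurable (Filter.Eventually.of_forall hM)
    have i2 : Integrable (fun x => G x * φ x) :=
      φ.integrable.bdd_mul (c := M') hG.1.aestronglyMeasurable (Filter.Eventually.of_forall hM')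
    have : ∫ x, q x • (F x - G x) = ∫ x, (F x * φ x - G x * φ x) := by
      congr 1; ext x; rw [hφa, Complex.real_smul]; ring
    rw [this, integral_sub i1 i2, hF.2.2, hG.2.2, sub_self]
  have := (hc.ae_eq_iff_eq volume (continuous_const (y := (0:ℂ)))).1 key
  ext x
  have h := congrFun this x
  exact sub_eq_zero.1 h

lemma ker_scale [Nontrivial V] {μ : V → ℝ} {m κ : ℝ} (hκ : 0 < κ)
    (hhom : ∀ c : ℝ, 0 < c → ∀ x : V, x ≠ 0 → μ (c • x) = c ^ m * μ x) {F : V → ℂ}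
    (hF : IsKer μ 1 F) :
    IsKer μ (κ ^ m) (fun x => ((κ ^ Module.finrank ℝ V)⁻¹ : ℝ) • F (κ⁻¹ • x)) := by
  set n := Module.finrank ℝ V with hn
  refine ⟨by have := hF.1; fun_prop, ?_, fun φ => ?_⟩
  · obtain ⟨M, hM⟩ := hF.2.1
    refine ⟨(κ ^ n)⁻¹ * M, fun x => ?_⟩
    rw [norm_smul, Real.norm_of_nonneg (by positivity)]
    gcongr
    exact hM _
  · set L : V ≃L[ℝ] V := ContinuousLinearEquiv.smulLeft (Units.mk0 κ hκ.ne') with hL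
    set φ' : SchwartzMap V ℂ := SchwartzMap.compCLMOfContinuousLinearEquiv ℝ L φ with hφ'
    have hφa : ∀ x, φ' x = φ (κ • x) := fun x => rfl
    have h1 := hF.2.2 φ'
    have e1 : ∫ x, (((κ ^ n)⁻¹ : ℝ) • F (κ⁻¹ • x)) * φ x = ∫ x, F x * φ' x := by
      have := Measure.integral_comp_smul (volume : Measure V) (fun y => F y * φ (κ • y)) κ⁻¹
      simp only [smul_inv_smul₀ hκ.ne'] at this
      simp only [hφa, smul_mul_assoc]
      rw [integral_smul, this, smul_smul, abs_of_nonneg (by positivity)]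
      rw [← hn, inv_pow, inv_inv, inv_mul_cancel₀ (by positivity), one_smul]
    rw [e1, h1]
    have e2 : ∀ ξ, ∫ x, ex ⟪ξ, x⟫ * φ' x = ((κ ^ n)⁻¹ : ℝ) • ∫ x, ex ⟪κ⁻¹ • ξ, x⟫ * φ x := by
      intro ξ
      have := Measure.integral_comp_smul (volume : Measure V)
        (fun x => ex ⟪κ⁻¹ • ξ, x⟫ * φ x) κ
      rw [abs_of_nonneg (by positivity)] at this
      rw [← this]
      congr 1; ext x
      rw [hφa, inner_smul_left, inner_smul_right]
      simp [hκ.ne']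
    simp_rw [e2]
    have := Measure.integral_comp_smul (volume : Measure V)
      (fun ξ => ex (1 * μ ξ) * ((κ ^ n)⁻¹ : ℝ) • ∫ x, ex ⟪κ⁻¹ • ξ, x⟫ * φ x) κ
    simp only [inv_smul_smul₀ hκ.ne'] at this
    rw [abs_of_nonneg (by positivity)] at this
    simp only [mul_smul_comm] at this ⊢
    rw [integral_smul, integral_smul, smul_right_inj (by positivity)] at this
    rw [integral_smul, ← this]
    refine integral_congr_ae ?_
    filter_upwards [ae_ne_zero'] with ξ hξ
    rw [hhom κ hκ ξ hξ, one_mul]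

lemma ker_formula [Nontrivial V] {μ : V → ℝ} {m : ℝ} (hm : 0 < m)
    (hhom : ∀ c : ℝ, 0 < c → ∀ x : V, x ≠ 0 → μ (c • x) = c ^ m * μ x) {EE : ℝ → V → ℂ}
    (hEE : ∀ t : ℝ, 0 < t → IsKer μ t (EE t)) (t : ℝ) (ht : 0 < t) (x : V) :
    EE t x = ((t ^ (-(Module.finrank ℝ V / m)) : ℝ)) • EE 1 (t ^ (-(1 / m)) • x) := by
  set κ := t ^ (1 / m) with hκ
  have hκ0 : 0 < κ := by positivity
  have hκm : κ ^ m = t := by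
    rw [hκ, ← Real.rpow_mul ht.le, one_div, inv_mul_cancel₀ hm.ne', Real.rpow_one]
  have h1 := ker_scale hκ0 hhom (hEE 1 one_pos)
  rw [hκm] at h1
  rw [ker_unique (hEE t ht) h1]
  rw [Real.rpow_neg ht.le, Real.rpow_neg ht.le, ← hκ]
  congr 2
  rw [hκ, ← Real.rpow_natCast, ← Real.rpow_mul ht.le]
  congr 1
  field_simp

lemma ker_bound [Nontrivial V] {μ : V → ℝ} {m : ℝ} (hm : 0 < m)
    (hhom : ∀ c : ℝ, 0 < c → ∀ x : V, x ≠ 0 → μ (c • x) = c ^ m * μ x) {EE : ℝ → V → ℂ}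
    (hEE : ∀ t : ℝ, 0 < t → IsKer μ t (EE t)) :
    ∃ M : ℝ, 0 ≤ M ∧ ∀ t, 0 < t → ∀ x, ‖EE t x‖ ≤ M * t ^ (-(Module.finrank ℝ V / m)) := by
  obtain ⟨M, hM⟩ := (hEE 1 one_pos).2.1
  refine ⟨M, (norm_nonneg _).trans (hM 0), fun t ht x => ?_⟩
  rw [ker_formula hm hhom hEE t ht x, norm_smul, Real.norm_of_nonneg (by positivity), mul_comm]
  gcongr
  exact hM _

lemma ker_cont [Nontrivial V] {μ : V → ℝ} {m : ℝ} (hm : 0 < m)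
    (hhom : ∀ c : ℝ, 0 < c → ∀ x : V, x ≠ 0 → μ (c • x) = c ^ m * μ x) {EE : ℝ → V → ℂ}
    (hEE : ∀ t : ℝ, 0 < t → IsKer μ t (EE t)) :
    ContinuousOn (fun p : ℝ × V => EE p.1 p.2) (Set.Ioi 0 ×ˢ Set.univ) := by
  have h1 : ContinuousOn (fun p : ℝ × V => ((p.1 ^ (-(Module.finrank ℝ V / m)) : ℝ)) •
      EE 1 (p.1 ^ (-(1 / m)) • p.2)) (Set.Ioi 0 ×ˢ Set.univ) := by
    have hp : ∀ a : ℝ, ContinuousOn (fun p : ℝ × V => p.1 ^ a) (Set.Ioi 0 ×ˢ Set.univ) := by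
      intro a p hp
      have : 0 < p.1 := hp.1
      exact (continuousAt_fst.rpow_const (Or.inl this.ne')).continuousWithinAt
    exact (hp _).smul ((hEE 1 one_pos).1.comp_continuousOn ((hp _).smul continuousOn_snd))
  exact h1.congr fun p hp => ker_formula hm hhom hEE p.1 hp.1 p.2

end ker

open MeasureTheory Real Complex
open scoped ENNReal RealInnerProductSpace

set_option linter.unusedSectionVars false

noncomputable section

section duh

variable {V : Type*} [NormedAddCommGroup V] [InnerProductSpace ℝ V] [FiniteDimensional ℝ V]
  [MeasurableSpace V] [BorelSpace V]

/-- sup-norm hypotheses on the kernel -/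
structure KerH (E : ℝ → V → ℂ) (M α : ℝ) : Prop where
  M0 : 0 ≤ M
  hα : α < 1
  bound : ∀ t, 0 < t → ∀ x, ‖E t x‖ ≤ M * t ^ (-α)
  cont : ContinuousOn (fun p : ℝ × V => E p.1 p.2) (Set.Ioi 0 ×ˢ Set.univ)

lemma KerH.cont1 {E : ℝ → V → ℂ} {M α : ℝ} (h : KerH E M α) {t : ℝ} (ht : 0 < t) :
    Continuous (E t) := by
  have := h.cont.comp_continuous (f := fun x : V => (t, x)) (by fun_prop) (fun x => ⟨ht, trivial⟩)
  exact this

lemma KerH.meas {E : ℝ → V → ℂ} {M α : ℝ} (h : KerH E M α) :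
    Measurable ((Set.Ioi (0:ℝ) ×ˢ (Set.univ : Set V)).indicator fun p : ℝ × V => E p.1 p.2) := by
  classical
  have hm : MeasurableSet (Set.Ioi (0:ℝ) ×ˢ (Set.univ : Set V)) :=
    measurableSet_Ioi.prod MeasurableSet.univ
  rw [← Set.piecewise_eq_indicator]
  exact h.cont.measurable_piecewise continuousOn_const hm

/-- Duhamel integrand -/
def DI (E : ℝ → V → ℂ) (w : V → ℂ) (Λ : ℝ) (v : ℝ × V → ℂ) (q : ℝ × V) (p : ℝ × V) : ℂ :=
  (Set.Ioo 0 q.1).indicator (fun τ => ((Real.exp (-(Λ * τ)) : ℝ) : ℂ) *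
    (E τ (q.2 - p.2) * v (q.1 - τ, p.2) * w p.2)) p.1

/-- the dominating function -/
def domf (M α Λ τ : ℝ) : ℝ := (Set.Ioi 0).indicator (fun τ => M * (τ ^ (-α) * Real.exp (-(Λ * τ)))) τ

lemma domf_nonneg {M α Λ : ℝ} (hM : 0 ≤ M) (τ : ℝ) : 0 ≤ domf M α Λ τ := by
  unfold domf
  refine Set.indicator_nonneg (fun τ hτ => ?_) τ
  have : 0 < τ := hτ
  positivity

lemma domf_integrable {M α Λ : ℝ} (hα : α < 1) (hΛ : 0 < Λ) : Integrable (domf M α Λ) := by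
  unfold domf
  rw [integrable_indicator_iff measurableSet_Ioi]
  refine Integrable.const_mul ?_ _
  have := integrableOn_rpow_mul_exp_neg_mul_rpow (s := -α) (p := 1) (b := Λ) (by linarith)
    one_pos hΛ
  have h2 : IntegrableOn (fun x : ℝ => x ^ (-α) * Real.exp (-(Λ * x))) (Set.Ioi 0) := by
    simpa [Real.rpow_one, neg_mul] using this
  exact h2

lemma domf_integral {M α Λ : ℝ} (hα : α < 1) (hΛ : 0 < Λ) :
    ∫ τ, domf M α Λ τ = M * ((1 / Λ) ^ (1 - α) * Real.Gamma (1 - α)) := by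
  unfold domf
  rw [integral_indicator measurableSet_Ioi, integral_const_mul]
  have := Real.integral_rpow_mul_exp_neg_mul_Ioi (a := 1 - α) (r := Λ) (by linarith) hΛ
  rw [← this]
  congr 3; ext τ; congr 2; ring

lemma exists_weight (M α R : ℝ) (hα : α < 1) :
    ∃ Λ : ℝ, 0 < Λ ∧ R * ∫ τ, domf M α Λ τ ≤ 1 / 2 := by
  have h1 : Filter.Tendsto (fun Λ : ℝ => R * (M * (Λ ^ (-(1 - α)) * Real.Gamma (1 - α))))
      Filter.atTop (nhds (R * (M * (0 * Real.Gamma (1 - α))))) :=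
    (((tendsto_rpow_neg_atTop (by linarith)).mul_const _).const_mul _).const_mul _
  rw [zero_mul, mul_zero, mul_zero] at h1
  have h2 := h1.eventually (ge_mem_nhds (show (0:ℝ) < 1 / 2 by norm_num))
  obtain ⟨Λ, h3, h4⟩ := (h2.and (Filter.eventually_gt_atTop 0)).exists
  refine ⟨Λ, h4, ?_⟩
  rw [domf_integral hα h4, one_div, Real.inv_rpow h4.le, ← Real.rpow_neg h4.le]
  exact h3

variable {E : ℝ → V → ℂ} {M α : ℝ} {w : V → ℂ}

lemma DI_meas (hE : KerH E M α) (hw : Measurable w) (Λ : ℝ) {v : ℝ × V → ℂ} (hv : Measurable v)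
    (q : ℝ × V) : Measurable (DI E w Λ v q) := by
  have e : DI E w Λ v q = (Set.Ioo 0 q.1 ×ˢ (Set.univ : Set V)).indicator (fun p =>
      ((Real.exp (-(Λ * p.1)) : ℝ) : ℂ) *
    ((Set.Ioi (0:ℝ) ×ˢ (Set.univ : Set V)).indicator (fun p : ℝ × V => E p.1 p.2)
      (p.1, q.2 - p.2) * v (q.1 - p.1, p.2) * w p.2)) := by
    ext p
    by_cases hp : p.1 ∈ Set.Ioo 0 q.1
    · have h2 : p ∈ Set.Ioo 0 q.1 ×ˢ (Set.univ : Set V) := ⟨hp, trivial⟩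
      have h3 : ((p.1, q.2 - p.2) : ℝ × V) ∈ Set.Ioi (0:ℝ) ×ˢ (Set.univ : Set V) := ⟨hp.1, trivial⟩
      rw [DI, Set.indicator_of_mem hp, Set.indicator_of_mem h2, Set.indicator_of_mem h3]
    · have h2 : p ∉ Set.Ioo 0 q.1 ×ˢ (Set.univ : Set V) := fun h => hp h.1
      rw [DI, Set.indicator_of_notMem hp, Set.indicator_of_notMem h2]
  rw [e]
  refine Measurable.indicator ?_ (measurableSet_Ioo.prod MeasurableSet.univ)
  have h1 := hE.meas.comp (by fun_prop : Measurable fun p : ℝ × V => (p.1, q.2 - p.2))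
  have h2 := hv.comp (by fun_prop : Measurable fun p : ℝ × V => (q.1 - p.1, p.2))
  have h3 : Measurable fun p : ℝ × V => w p.2 := hw.comp measurable_snd
  have h4 : Measurable fun p : ℝ × V => ((Real.exp (-(Λ * p.1)) : ℝ) : ℂ) := by fun_prop
  exact h4.mul ((h1.mul h2).mul h3)

lemma DI_bound (hE : KerH E M α) (hw1 : ∀ y, ‖w y‖ ≤ 1) (Λ : ℝ) {v : ℝ × V → ℂ} {N : ℝ}
    (hN : 0 ≤ N) (q : ℝ × V) (hv : ∀ s, s < q.1 → ∀ y, ‖v (s, y)‖ ≤ N)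
    (p : ℝ × V) : ‖DI E w Λ v q p‖ ≤ N * domf M α Λ p.1 := by
  by_cases hp : p.1 ∈ Set.Ioo 0 q.1
  · have h0 : 0 < p.1 := hp.1
    rw [DI, Set.indicator_of_mem hp, domf, Set.indicator_of_mem (by exact h0), norm_mul, norm_mul,
      norm_mul, Complex.norm_real, Real.norm_of_nonneg (Real.exp_pos _).le]
    have h1 := hE.bound p.1 h0 (q.2 - p.2)
    have h2 := hv (q.1 - p.1) (by linarith) p.2
    have h3 := hw1 p.2
    calc _ ≤ Real.exp (-(Λ * p.1)) * (M * p.1 ^ (-α) * N * 1) := by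
          have := hE.M0
          gcongr
      _ = _ := by ring
  · rw [DI, Set.indicator_of_notMem hp, norm_zero]
    exact mul_nonneg hN (domf_nonneg hE.M0 _)

/-- Duhamel operator -/
def DO (E : ℝ → V → ℂ) (w : V → ℂ) (ρ : Measure V) (Λ : ℝ) (v : ℝ × V → ℂ) (q : ℝ × V) : ℂ :=
  ∫ p, DI E w Λ v q p ∂((volume : Measure ℝ).prod ρ)

variable (ρ : Measure V) [IsFiniteMeasure ρ]

lemma DI_integrable (hE : KerH E M α) (hw : Measurable w) (hw1 : ∀ y, ‖w y‖ ≤ 1) {Λ : ℝ}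
    (hΛ : 0 < Λ) {v : ℝ × V → ℂ} (hvm : Measurable v) {N : ℝ} (hN : 0 ≤ N) (q : ℝ × V)
    (hv : ∀ s, s < q.1 → ∀ y, ‖v (s, y)‖ ≤ N) :
    Integrable (DI E w Λ v q) ((volume : Measure ℝ).prod ρ) := by
  refine Integrable.mono' (g := fun p => N * domf M α Λ p.1) ?_
    (DI_meas hE hw Λ hvm q).aestronglyMeasurable
    (Filter.Eventually.of_forall (DI_bound hE hw1 Λ hN q hv))
  exact ((domf_integrable hE.hα hΛ).const_mul N).comp_fst ρ

lemma DO_bound (hE : KerH E M α) (hw1 : ∀ y, ‖w y‖ ≤ 1) {Λ : ℝ}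
    (hΛ : 0 < Λ) {v : ℝ × V → ℂ} {N : ℝ} (hN : 0 ≤ N) (q : ℝ × V)
    (hv : ∀ s, s < q.1 → ∀ y, ‖v (s, y)‖ ≤ N) :
    ‖DO E w ρ Λ v q‖ ≤ N * (ρ.real Set.univ * ∫ τ, domf M α Λ τ) := by
  refine (norm_integral_le_of_norm_le (((domf_integrable hE.hα hΛ).const_mul N).comp_fst ρ)
    (Filter.Eventually.of_forall (DI_bound hE hw1 Λ hN q hv))).trans (le_of_eq ?_)
  rw [integral_fun_fst (fun τ => N * domf M α Λ τ), integral_const_mul, smul_eq_mul]; ring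

lemma DO_cont (hE : KerH E M α) (hw : Measurable w) (hw1 : ∀ y, ‖w y‖ ≤ 1) {Λ : ℝ}
    (hΛ : 0 < Λ) {v : ℝ × V → ℂ} (hvc : Continuous v) {N : ℝ} (hN : 0 ≤ N)
    (hv : ∀ q, ‖v q‖ ≤ N) : Continuous (DO E w ρ Λ v) := by
  rw [continuous_iff_continuousAt]
  intro q
  refine continuousAt_of_dominated (bound := fun p => N * domf M α Λ p.1)
    (Filter.Eventually.of_forall fun q => (DI_meas hE hw Λ hvc.measurable q).aestronglyMeasurable)
    (Filter.Eventually.of_forall fun q => Filter.Eventually.of_forall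
      (DI_bound hE hw1 Λ hN q fun s _ y => hv _))
    (((domf_integrable hE.hα hΛ).const_mul N).comp_fst ρ) ?_
  have h1 : ∀ᵐ p : ℝ × V ∂((volume : Measure ℝ).prod ρ), p.1 ≠ q.1 := by
    have : ∀ᵐ τ : ℝ, τ ≠ q.1 := by rw [ae_iff]; simp
    exact Measure.quasiMeasurePreserving_fst.ae this
  filter_upwards [h1] with p hp
  by_cases hp0 : 0 < p.1
  · rcases lt_or_gt_of_ne hp with hlt | hgt
    · have : (fun q : ℝ × V => DI E w Λ v q p) =ᶠ[nhds q] fun q =>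
          ((Real.exp (-(Λ * p.1)) : ℝ) : ℂ) * (E p.1 (q.2 - p.2) * v (q.1 - p.1, p.2) * w p.2) := by
        filter_upwards [(isOpen_lt continuous_const continuous_fst).mem_nhds
          (show q ∈ {q : ℝ × V | p.1 < q.1} from hlt)] with q' hq'
        rw [DI, Set.indicator_of_mem (show p.1 ∈ Set.Ioo 0 q'.1 from ⟨hp0, hq'⟩)]
      refine ContinuousAt.congr ?_ this.symm
      have := hE.cont1 hp0
      fun_prop
    · have : (fun q : ℝ × V => DI E w Λ v q p) =ᶠ[nhds q] fun q => 0 := by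
        filter_upwards [(isOpen_lt continuous_fst continuous_const).mem_nhds
          (show q ∈ {q : ℝ × V | q.1 < p.1} from hgt)] with q' hq'
        rw [DI, Set.indicator_of_notMem]
        intro h; exact absurd h.2 (not_lt.2 (le_of_lt hq'))
      exact continuousAt_const.congr this.symm
  · have : (fun q : ℝ × V => DI E w Λ v q p) = fun q => 0 := by
      ext q'
      rw [DI, Set.indicator_of_notMem]
      intro h; exact hp0 h.1
    rw [this]; exact continuousAt_const

lemma DO_sub (hE : KerH E M α) (hw : Measurable w) (hw1 : ∀ y, ‖w y‖ ≤ 1) {Λ : ℝ}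
    (hΛ : 0 < Λ) {v v' : ℝ × V → ℂ} (hvm : Measurable v) (hvm' : Measurable v') {N : ℝ} (hN : 0 ≤ N)
    (q : ℝ × V) (hv : ∀ q, ‖v q‖ ≤ N) (hv' : ∀ q, ‖v' q‖ ≤ N) :
    DO E w ρ Λ v q - DO E w ρ Λ v' q = DO E w ρ Λ (fun q => v q - v' q) q := by
  unfold DO
  rw [← integral_sub (DI_integrable ρ hE hw hw1 hΛ hvm hN q fun _ _ _ => hv _)
    (DI_integrable ρ hE hw hw1 hΛ hvm' hN q fun _ _ _ => hv' _)]
  congr 1; ext p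
  unfold DI
  by_cases hp : p.1 ∈ Set.Ioo 0 q.1
  · simp only [Set.indicator_of_mem hp]; ring
  · simp only [Set.indicator_of_notMem hp]; ring

end duh

open MeasureTheory Real Complex
open scoped ENNReal RealInnerProductSpace BoundedContinuousFunction

set_option linter.unusedSectionVars false

noncomputable section

section fix

variable {V : Type*} [NormedAddCommGroup V] [InnerProductSpace ℝ V] [FiniteDimensional ℝ V]
  [MeasurableSpace V] [BorelSpace V]

variable {E : ℝ → V → ℂ} {M α : ℝ} {w : V → ℂ} (ρ : Measure V) [IsFiniteMeasure ρ]

lemma exists_fixed (hE : KerH E M α) (hw : Measurable w) (hw1 : ∀ y, ‖w y‖ ≤ 1) {u0 : ℝ × V → ℂ}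
    (hc : Continuous u0) {B : ℝ} (hB : ∀ q, ‖u0 q‖ ≤ B) :
    ∃ Λ : ℝ, 0 < Λ ∧ ∃ v : (ℝ × V) →ᵇ ℂ, ∀ q : ℝ × V, v q =
      ((Real.exp (-(Λ * max q.1 0)) : ℝ) : ℂ) * u0 q + (2 * (Real.pi : ℂ)) * Complex.I *
        DO E w ρ Λ v q := by
  obtain ⟨Λ, hΛ, hhalf⟩ := exists_weight M α (2 * Real.pi * ρ.real Set.univ) hE.hα
  refine ⟨Λ, hΛ, ?_⟩
  set J := ∫ τ, domf M α Λ τ with hJ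
  have hJ0 : 0 ≤ J := integral_nonneg (domf_nonneg hE.M0)
  have hB0 : 0 ≤ B := (norm_nonneg _).trans (hB 0)
  have hcoef : ‖(2 * (Real.pi : ℂ)) * Complex.I‖ = 2 * Real.pi := by
    simp [abs_of_pos Real.pi_pos]
  have hcont : ∀ v : (ℝ × V) →ᵇ ℂ, Continuous fun q : ℝ × V =>
      ((Real.exp (-(Λ * max q.1 0)) : ℝ) : ℂ) * u0 q + (2 * (Real.pi : ℂ)) * Complex.I *
        DO E w ρ Λ v q := by
    intro v
    have := DO_cont ρ hE hw hw1 hΛ v.continuous (norm_nonneg v) v.norm_coe_le_norm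
    fun_prop
  have hbd : ∀ v : (ℝ × V) →ᵇ ℂ, ∀ q : ℝ × V, ‖((Real.exp (-(Λ * max q.1 0)) : ℝ) : ℂ) * u0 q +
      (2 * (Real.pi : ℂ)) * Complex.I * DO E w ρ Λ v q‖ ≤
        B + 2 * Real.pi * (‖v‖ * (ρ.real Set.univ * J)) := by
    intro v q
    refine (norm_add_le _ _).trans ?_
    rw [norm_mul, norm_mul, hcoef, Complex.norm_real, Real.norm_of_nonneg (Real.exp_pos _).le]
    have h1 := DO_bound ρ hE hw1 hΛ (norm_nonneg v) q fun s _ y => v.norm_coe_le_norm (s, y)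
    have h2 : Real.exp (-(Λ * max q.1 0)) ≤ 1 := by
      rw [Real.exp_le_one_iff]
      have := le_max_right q.1 0
      nlinarith
    gcongr
    calc _ ≤ 1 * B := by gcongr; exact hB q
      _ = B := one_mul _
  set Φ : ((ℝ × V) →ᵇ ℂ) → ((ℝ × V) →ᵇ ℂ) := fun v =>
    BoundedContinuousFunction.ofNormedAddCommGroup _ (hcont v) _ (hbd v) with hΦ
  have hΦa : ∀ v q, Φ v q = ((Real.exp (-(Λ * max q.1 0)) : ℝ) : ℂ) * u0 q +
      (2 * (Real.pi : ℂ)) * Complex.I * DO E w ρ Λ v q := fun v q => rfl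
  have hcontr : ContractingWith (1 / 2) Φ := by
    refine ⟨by norm_num, LipschitzWith.of_dist_le_mul fun v v' => ?_⟩
    rw [BoundedContinuousFunction.dist_le (by positivity)]
    intro q
    rw [hΦa, hΦa, dist_eq_norm, add_sub_add_left_eq_sub, ← mul_sub, norm_mul, hcoef,
      DO_sub ρ hE hw hw1 hΛ v.continuous.measurable v'.continuous.measurable
        (le_max_of_le_left (norm_nonneg v)) q
        (fun q => (v.norm_coe_le_norm q).trans (le_max_left _ ‖v'‖))
        (fun q => (v'.norm_coe_le_norm q).trans (le_max_right _ _))]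
    have h1 := DO_bound ρ hE hw1 hΛ (v := fun q => v q - v' q) (dist_nonneg (x := v) (y := v')) q
      fun s _ y => by rw [← dist_eq_norm]; exact BoundedContinuousFunction.dist_coe_le_dist _
    calc _ ≤ 2 * Real.pi * (dist v v' * (ρ.real Set.univ * J)) := by gcongr
      _ = (2 * Real.pi * ρ.real Set.univ * J) * dist v v' := by ring
      _ ≤ (1 / 2) * dist v v' := by gcongr
      _ = _ := by simp
  refine ⟨hcontr.fixedPoint Φ, fun q => ?_⟩
  conv_lhs => rw [← hcontr.fixedPoint_isFixedPt]
  exact hΦa _ q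

lemma exists_mild (hE : KerH E M α) (hw : Measurable w) (hw1 : ∀ y, ‖w y‖ ≤ 1) {u0 : ℝ × V → ℂ}
    (hc : Continuous u0) {B : ℝ} (hB : ∀ q, ‖u0 q‖ ≤ B) :
    ∃ u : ℝ × V → ℂ, Continuous u ∧ (∃ Λ A : ℝ, 0 < Λ ∧ 0 ≤ A ∧
      ∀ t x, ‖u (t, x)‖ ≤ A * Real.exp (Λ * t)) ∧
      ∀ t, 0 ≤ t → ∀ x, u (t, x) = u0 (t, x) + (2 * (Real.pi : ℂ)) * Complex.I *
        ∫ p, DI E w 0 u (t, x) p ∂((volume : Measure ℝ).prod ρ) := by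
  obtain ⟨Λ, hΛ, v, hv⟩ := exists_fixed ρ hE hw hw1 hc hB
  refine ⟨fun q => ((Real.exp (Λ * q.1) : ℝ) : ℂ) * v q, by fun_prop, ⟨Λ, ‖v‖, hΛ, norm_nonneg v,
    fun t x => ?_⟩, fun t ht x => ?_⟩
  · rw [norm_mul, Complex.norm_real, Real.norm_of_nonneg (Real.exp_pos _).le, mul_comm]
    gcongr
    exact v.norm_coe_le_norm _
  · have h1 : ∀ p, DI E w 0 (fun q => ((Real.exp (Λ * q.1) : ℝ) : ℂ) * v q) (t, x) p =
        ((Real.exp (Λ * t) : ℝ) : ℂ) * DI E w Λ v (t, x) p := by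
      intro p
      unfold DI
      by_cases hp : p.1 ∈ Set.Ioo 0 t
      · simp only [Set.indicator_of_mem hp]
        have : ((Real.exp (Λ * (t - p.1)) : ℝ) : ℂ) =
            ((Real.exp (Λ * t) : ℝ) : ℂ) * ((Real.exp (-(Λ * p.1)) : ℝ) : ℂ) := by
          rw [← Complex.ofReal_mul, ← Real.exp_add]; congr 2; ring
        rw [this]; simp; ring
      · simp only [Set.indicator_of_notMem hp]; ring
    simp only [h1]
    rw [integral_const_mul]
    conv_lhs => rw [hv]
    rw [DO]
    simp only [max_eq_left ht]
    have : ((Real.exp (Λ * t) : ℝ) : ℂ) * ((Real.exp (-(Λ * t)) : ℝ) : ℂ) = 1 := by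
      rw [← Complex.ofReal_mul, ← Real.exp_add]; simp
    rw [mul_add, ← mul_assoc, this]; ring

lemma DI0_integrable (hE : KerH E M α) (hw : Measurable w) (hw1 : ∀ y, ‖w y‖ ≤ 1)
    {u : ℝ × V → ℂ} (hum : Measurable u) {N : ℝ} (hN : 0 ≤ N) (q : ℝ × V)
    (hu : ∀ s, s < q.1 → ∀ y, ‖u (s, y)‖ ≤ N) :
    Integrable (DI E w 0 u q) ((volume : Measure ℝ).prod ρ) := by
  have h1 := DI_integrable ρ hE hw hw1 (Λ := 1) one_pos hum hN q hu
  refine (h1.norm.const_mul (Real.exp q.1)).mono'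
    (DI_meas hE hw 0 hum q).aestronglyMeasurable (Filter.Eventually.of_forall fun p => ?_)
  unfold DI
  by_cases hp : p.1 ∈ Set.Ioo 0 q.1
  · simp only [Set.indicator_of_mem hp]
    rw [norm_mul ((Real.exp (-(0 * p.1)) : ℝ) : ℂ), norm_mul ((Real.exp (-(1 * p.1)) : ℝ) : ℂ),
      ← mul_assoc, Complex.norm_real, Complex.norm_real,
      Real.norm_of_nonneg (Real.exp_pos _).le, Real.norm_of_nonneg (Real.exp_pos _).le,
      ← Real.exp_add]
    gcongr
    have := hp.2
    linarith
  · simp only [Set.indicator_of_notMem hp]; simp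

lemma DO_iter (hE : KerH E M α) (hw : Measurable w) (hw1 : ∀ y, ‖w y‖ ≤ 1)
    {u : ℝ × V → ℂ} (hum : Measurable u) {N : ℝ} (hN : 0 ≤ N) (t : ℝ) (x : V)
    (hu : ∀ s, s < t → ∀ y, ‖u (s, y)‖ ≤ N) :
    (∀ s ∈ Set.Ioo (0 : ℝ) t, Integrable (fun y => E (t - s) (x - y) * u (s, y) * w y) ρ) ∧
    IntegrableOn (fun s => ∫ y, E (t - s) (x - y) * u (s, y) * w y ∂ρ) (Set.Ioo (0 : ℝ) t) ∧
    ∫ p, DI E w 0 u (t, x) p ∂((volume : Measure ℝ).prod ρ) =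
      ∫ s in Set.Ioo (0 : ℝ) t, ∫ y, E (t - s) (x - y) * u (s, y) * w y ∂ρ := by
  have hi := DI0_integrable ρ hE hw hw1 hum hN (t, x) hu
  have key : ∀ s, ∫ y, DI E w 0 u (t, x) (t - s, y) ∂ρ = (Set.Ioo (0:ℝ) t).indicator
      (fun s => ∫ y, E (t - s) (x - y) * u (s, y) * w y ∂ρ) s := by
    intro s
    unfold DI
    by_cases hs : s ∈ Set.Ioo (0:ℝ) t
    · have h1 : t - s ∈ Set.Ioo 0 t := ⟨by linarith [hs.2], by linarith [hs.1]⟩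
      simp only [Set.indicator_of_mem hs, Set.indicator_of_mem h1]
      simp
    · have h1 : t - s ∉ Set.Ioo 0 t := fun h => hs ⟨by linarith [h.2], by linarith [h.1]⟩
      simp only [Set.indicator_of_notMem hs, Set.indicator_of_notMem h1]
      simp
  have hi1 := hi.integral_prod_left
  have hi2 := (hi1.comp_sub_left t)
  simp only [key] at hi2
  refine ⟨fun s hs => ?_, (integrable_indicator_iff measurableSet_Ioo).1 hi2, ?_⟩
  · refine Integrable.mono' (g := fun _ => M * (t - s) ^ (-α) * N * 1) (integrable_const _) ?_ ?_
    · have h1 : Continuous (E (t - s)) := hE.cont1 (by linarith [hs.2])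
      have h2 : Measurable fun y => u (s, y) := hum.comp (by fun_prop)
      have h3 : Measurable fun y => E (t - s) (x - y) := h1.measurable.comp (by fun_prop)
      exact ((h3.mul h2).mul hw).aestronglyMeasurable
    · refine Filter.Eventually.of_forall fun y => ?_
      rw [norm_mul, norm_mul]
      have hts : 0 < t - s := by linarith [hs.2]
      have := hE.M0
      gcongr
      · exact hE.bound _ hts _
      · exact hu s hs.2 y
      · exact hw1 y
  · rw [integral_prod _ hi, ← integral_sub_left_eq_self _ volume t]
    simp only [key]
    rw [integral_indicator measurableSet_Ioo]

end fix

open MeasureTheory Real Complex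
open scoped ENNReal RealInnerProductSpace

set_option linter.unusedSectionVars false

noncomputable section

section west

variable (d : ℕ) (g : SchwartzMap (EuclideanSpace ℝ (Fin d)) ℂ)

lemma wnorm_eq (v : EuclideanSpace ℝ (Fin d) → ℂ) :
    wOneInfNorm d g v = ⨆ x, ∫⁻ ξ, ‖gaborT d g v x ξ‖ₑ := rfl

lemma testfn_norm (x ξ y : EuclideanSpace ℝ (Fin d)) : ‖testfn g x ξ y‖ = ‖g (y - x)‖ := by
  rw [testfn_apply, norm_mul, norm_ex, one_mul, RCLike.norm_conj]

lemma gshift_integrable (x : EuclideanSpace ℝ (Fin d)) : Integrable fun y => ‖g (y - x)‖ :=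
  (g.integrable.comp_sub_right x).norm

lemma testfn_cont (x : EuclideanSpace ℝ (Fin d)) :
    Continuous fun q : EuclideanSpace ℝ (Fin d) × EuclideanSpace ℝ (Fin d) =>
      testfn g x q.1 q.2 := by
  simp only [testfn_apply]
  have h1 := g.continuous
  have h2 := continuous_ex
  have h3 : Continuous fun q : EuclideanSpace ℝ (Fin d) × EuclideanSpace ℝ (Fin d) =>
      ex (-⟪q.1, q.2⟫) := h2.comp (by fun_prop)
  have h4 : Continuous fun q : EuclideanSpace ℝ (Fin d) × EuclideanSpace ℝ (Fin d) =>
      (starRingEnd ℂ) (g (q.2 - x)) := Complex.continuous_conj.comp (h1.comp (by fun_prop))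
  exact h3.mul h4

lemma gaborT_integrable {v : EuclideanSpace ℝ (Fin d) → ℂ} (hv : Measurable v) {M : ℝ}
    (hM : ∀ x, ‖v x‖ ≤ M) (x ξ : EuclideanSpace ℝ (Fin d)) :
    Integrable fun y => v y * testfn g x ξ y := by
  refine Integrable.mono' ((gshift_integrable d g x).const_mul M) ?_
    (Filter.Eventually.of_forall fun y => ?_)
  · exact (hv.mul (testfn g x ξ).continuous.measurable).aestronglyMeasurable
  · rw [norm_mul, testfn_norm]
    gcongr
    exact hM y

lemma gaborT_add {v v' : EuclideanSpace ℝ (Fin d) → ℂ} (hv : Measurable v) {M : ℝ}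
    (hM : ∀ x, ‖v x‖ ≤ M) (hv' : Measurable v') {M' : ℝ}
    (hM' : ∀ x, ‖v' x‖ ≤ M') (x ξ : EuclideanSpace ℝ (Fin d)) :
    gaborT d g (fun y => v y + v' y) x ξ = gaborT d g v x ξ + gaborT d g v' x ξ := by
  simp only [gaborT_eq, add_mul]
  exact integral_add (gaborT_integrable d g hv hM x ξ) (gaborT_integrable d g hv' hM' x ξ)

lemma gaborT_meas {v : EuclideanSpace ℝ (Fin d) → ℂ} (hv : Measurable v)
    (x : EuclideanSpace ℝ (Fin d)) : Measurable fun ξ => gaborT d g v x ξ := by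
  simp only [gaborT_eq]
  have h1 : Measurable fun q : EuclideanSpace ℝ (Fin d) × EuclideanSpace ℝ (Fin d) =>
      v q.2 * testfn g x q.1 q.2 := (hv.comp measurable_snd).mul (testfn_cont d g x).measurable
  exact (h1.stronglyMeasurable.integral_prod_right' (ν := volume)).measurable

lemma wnorm_add {v v' : EuclideanSpace ℝ (Fin d) → ℂ} (hv : Measurable v) {M : ℝ}
    (hM : ∀ x, ‖v x‖ ≤ M) (hv' : Measurable v') {M' : ℝ}
    (hM' : ∀ x, ‖v' x‖ ≤ M') :
    wOneInfNorm d g (fun y => v y + v' y) ≤ wOneInfNorm d g v + wOneInfNorm d g v' := by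
  rw [wnorm_eq, wnorm_eq, wnorm_eq]
  refine iSup_le fun x => ?_
  calc ∫⁻ ξ, ‖gaborT d g (fun y => v y + v' y) x ξ‖ₑ
      ≤ ∫⁻ ξ, (‖gaborT d g v x ξ‖ₑ + ‖gaborT d g v' x ξ‖ₑ) := by
        refine lintegral_mono fun ξ => ?_
        simp only [gaborT_add d g hv hM hv' hM']
        exact enorm_add_le _ _
    _ = (∫⁻ ξ, ‖gaborT d g v x ξ‖ₑ) + ∫⁻ ξ, ‖gaborT d g v' x ξ‖ₑ :=
        lintegral_add_left (gaborT_meas d g hv x).enorm _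
    _ ≤ _ := add_le_add (le_iSup (fun x => ∫⁻ ξ, ‖gaborT d g v x ξ‖ₑ) x)
        (le_iSup (fun x => ∫⁻ ξ, ‖gaborT d g v' x ξ‖ₑ) x)

lemma gaborT_shift (F : EuclideanSpace ℝ (Fin d) → ℂ) (a : EuclideanSpace ℝ (Fin d)) (c : ℂ)
    (x ξ : EuclideanSpace ℝ (Fin d)) :
    gaborT d g (fun y => F (y - a) * c) x ξ = c * ex (-⟪ξ, a⟫) * gaborT d g F (x - a) ξ := by
  simp only [gaborT_eq]
  rw [← integral_const_mul]
  symm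
  rw [← integral_sub_right_eq_self _ a]
  congr 1; ext y
  rw [testfn_apply, testfn_apply, sub_sub_sub_cancel_right, inner_sub_right]
  have : ex (-⟪ξ, y⟫) = ex (-⟪ξ, a⟫) * ex (-(⟪ξ, y⟫ - ⟪ξ, a⟫)) := by
    rw [← ex_add]; congr 1; ring
  rw [this]; ring

lemma wnorm_shift (F : EuclideanSpace ℝ (Fin d) → ℂ) (a : EuclideanSpace ℝ (Fin d)) (c : ℂ) :
    wOneInfNorm d g (fun y => F (y - a) * c) ≤ wOneInfNorm d g F * ‖c‖ₑ := by
  rw [wnorm_eq, wnorm_eq]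
  refine iSup_le fun x => ?_
  simp only [gaborT_shift, enorm_mul]
  have h1 : ∀ r, ‖ex r‖ₑ = 1 := fun r => by rw [← ofReal_norm, norm_ex]; simp
  simp only [h1, mul_one]
  rw [lintegral_const_mul' _ _ (by simp), mul_comm]
  gcongr
  exact le_iSup (fun x => ∫⁻ ξ, ‖gaborT d g F x ξ‖ₑ) (x - a)

lemma wnorm_wave (ζ : EuclideanSpace ℝ (Fin d)) (c : ℂ) :
    wOneInfNorm d g (fun y => ex ⟪y, ζ⟫ * c) ≤ (∫⁻ η, ‖psi g η‖ₑ) * ‖c‖ₑ := by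
  rw [wnorm_eq]
  refine iSup_le fun x => le_of_eq ?_
  have h1 : ∀ r, ‖ex r‖ₑ = 1 := fun r => by rw [← ofReal_norm, norm_ex]; simp
  have h2 : ∀ ξ, gaborT d g (fun y => ex ⟪y, ζ⟫ * c) x ξ =
      c * ex ⟪ζ - ξ, x⟫ * psi g (ζ - ξ) := by
    intro ξ
    rw [gaborT_eq, psi_apply, ← integral_const_mul]
    symm
    rw [← integral_sub_right_eq_self _ x]
    symm
    congr 1; ext y
    rw [testfn_apply]
    have : ex ⟪y, ζ⟫ * ex (-⟪ξ, y⟫) = ex ⟪ζ - ξ, x⟫ * ex ⟪ζ - ξ, y - x⟫ := by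
      rw [← ex_add, ← ex_add]; congr 1
      rw [← inner_add_right, add_sub_cancel, inner_sub_left, real_inner_comm y ζ]; ring
    calc _ = ex ⟪y, ζ⟫ * ex (-⟪ξ, y⟫) * (c * (starRingEnd ℂ) (g (y - x))) := by ring
      _ = _ := by rw [this]; ring
  simp only [h2, enorm_mul, h1, mul_one]
  rw [lintegral_const_mul' _ _ (by simp), mul_comm,
    lintegral_sub_left_eq_self (fun η => ‖psi g η‖ₑ) ζ]

lemma meas_aux3 {Z : Type*} [MeasurableSpace Z] :
    Measurable fun r : (EuclideanSpace ℝ (Fin d) × Z) × EuclideanSpace ℝ (Fin d) =>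
      (r.1.2, r.2) := (measurable_snd.comp measurable_fst).prodMk measurable_snd

lemma comp_aux {Z : Type*} [MeasurableSpace Z]
    (T : EuclideanSpace ℝ (Fin d) × EuclideanSpace ℝ (Fin d) → ℂ) (hT : Measurable T) :
    Measurable fun r : (EuclideanSpace ℝ (Fin d) × Z) × EuclideanSpace ℝ (Fin d) =>
      T (r.1.1, r.2) :=
  hT.comp ((measurable_fst.comp measurable_fst).prodMk measurable_snd)

/-- Superposition principle for the `W` norm. -/
lemma wnorm_superpos {Z : Type*} [MeasurableSpace Z] (lam : Measure Z) [SFinite lam]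
    (K : Z → EuclideanSpace ℝ (Fin d) → ℂ) (hK : Measurable (Function.uncurry K))
    (k : Z → ℝ) (hk : Integrable k lam) (hKk : ∀ z y, ‖K z y‖ ≤ k z) :
    wOneInfNorm d g (fun y => ∫ z, K z y ∂lam) ≤ ∫⁻ z, wOneInfNorm d g (K z) ∂lam := by
  conv_lhs => rw [wnorm_eq]
  refine iSup_le fun x => ?_
  have h1 : ∀ ξ, gaborT d g (fun y => ∫ z, K z y ∂lam) x ξ = ∫ z, gaborT d g (K z) x ξ ∂lam := by
    intro ξ
    simp only [gaborT_eq, ← integral_mul_const]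
    rw [integral_integral_swap]
    refine Integrable.mono' (g := fun q => ‖g (q.1 - x)‖ * k q.2)
      ((gshift_integrable d g x).mul_prod hk) ?_ (Filter.Eventually.of_forall fun q => ?_)
    · refine Measurable.aestronglyMeasurable ?_
      exact (hK.comp measurable_swap).mul ((testfn g x ξ).continuous.measurable.comp measurable_fst)
    · simp only [Function.uncurry]
      rw [norm_mul, testfn_norm, mul_comm]
      gcongr
      exact hKk _ _
  have hmeas : Measurable fun q : EuclideanSpace ℝ (Fin d) × Z => gaborT d g (K q.2) x q.1 := by
    simp only [gaborT_eq]
    have h2 : Measurable fun r : (EuclideanSpace ℝ (Fin d) × Z) × EuclideanSpace ℝ (Fin d) =>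
        K r.1.2 r.2 * testfn g x r.1.1 r.2 := by
      have h3 : Measurable fun r : (EuclideanSpace ℝ (Fin d) × Z) × EuclideanSpace ℝ (Fin d) =>
          K r.1.2 r.2 := hK.comp (meas_aux3 d)
      exact h3.mul (comp_aux d (fun q => testfn g x q.1 q.2) (testfn_cont d g x).measurable)
    exact (h2.stronglyMeasurable.integral_prod_right' (ν := volume)).measurable
  calc ∫⁻ ξ, ‖gaborT d g (fun y => ∫ z, K z y ∂lam) x ξ‖ₑ
      ≤ ∫⁻ ξ, ∫⁻ z, ‖gaborT d g (K z) x ξ‖ₑ ∂lam := by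
        refine lintegral_mono fun ξ => ?_
        simp only [h1]
        exact enorm_integral_le_lintegral_enorm _
    _ = ∫⁻ z, ∫⁻ ξ, ‖gaborT d g (K z) x ξ‖ₑ ∂volume ∂lam := by
        rw [lintegral_lintegral_swap]
        exact hmeas.enorm.aemeasurable
    _ ≤ _ := by
        refine lintegral_mono fun z => ?_
        exact le_iSup (fun x => ∫⁻ ξ, ‖gaborT d g (K z) x ξ‖ₑ) x

lemma psi_fin : ∫⁻ η, ‖psi g η‖ₑ < ⊤ := (psi g).integrable.2

lemma wnorm_free {H : EuclideanSpace ℝ (Fin d) → ℂ} (hH : Integrable H) :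
    wOneInfNorm d g (fun y => ∫ ζ, ex ⟪y, ζ⟫ * H ζ) ≤ (∫⁻ η, ‖psi g η‖ₑ) * ∫⁻ ζ, ‖H ζ‖ₑ := by
  obtain ⟨H', hH', hae⟩ := hH.1
  have e1 : (fun y => ∫ ζ, ex ⟪y, ζ⟫ * H ζ) =
      fun y : EuclideanSpace ℝ (Fin d) => ∫ ζ, ex ⟪y, ζ⟫ * H' ζ := by
    ext y
    refine integral_congr_ae ?_
    filter_upwards [hae] with ζ hζ
    rw [hζ]
  have e2 : ∫⁻ ζ, ‖H ζ‖ₑ = ∫⁻ ζ, ‖H' ζ‖ₑ := by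
    refine lintegral_congr_ae ?_
    filter_upwards [hae] with ζ hζ
    rw [hζ]
  rw [e1, e2]
  refine (wnorm_superpos d g volume (fun ζ y => ex ⟪y, ζ⟫ * H' ζ) ?_ (fun ζ => ‖H' ζ‖)
    (hH.congr hae).norm fun ζ y => ?_).trans ?_
  · have h1 : Measurable fun q : EuclideanSpace ℝ (Fin d) × EuclideanSpace ℝ (Fin d) =>
        ex ⟪q.2, q.1⟫ := (continuous_ex.comp (by fun_prop)).measurable
    exact h1.mul (hH'.measurable.comp measurable_fst)
  · rw [norm_mul, norm_ex, one_mul]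
  · rw [← lintegral_const_mul' _ _ (psi_fin d g).ne]
    exact lintegral_mono fun ζ => wnorm_wave d g ζ _

end west

open MeasureTheory Real Complex
open scoped ENNReal RealInnerProductSpace

set_option linter.unusedSectionVars false

noncomputable section

section duhW

variable (d : ℕ) (g : SchwartzMap (EuclideanSpace ℝ (Fin d)) ℂ)
  {E : ℝ → EuclideanSpace ℝ (Fin d) → ℂ} {M α : ℝ} {w : EuclideanSpace ℝ (Fin d) → ℂ}
  (ρ : Measure (EuclideanSpace ℝ (Fin d))) [IsFiniteMeasure ρ]

lemma ind_rpow_integrable {T s : ℝ} (hT : 0 < T) (hs : -1 < s) (c : ℝ) :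
    Integrable ((Set.Ioo 0 T).indicator fun τ : ℝ => c * τ ^ s) := by
  rw [integrable_indicator_iff measurableSet_Ioo]
  have h1 := (intervalIntegral.integrableOn_Ioo_rpow_iff (s := s) hT).2 hs
  exact Integrable.const_mul h1 c

lemma duh_W (hE : KerH E M α) {T : ℝ} (hT : 0 < T) {β : ℝ} {C : ℝ≥0∞}
    (hW : ∀ t, 0 < t → t ≤ T → wOneInfNorm d g (E t) ≤ C * ENNReal.ofReal (t ^ (-β)))
    {b : ℝ × EuclideanSpace ℝ (Fin d) → ℂ} (hb : Measurable b) {N : ℝ} (hN : ∀ p, ‖b p‖ ≤ N)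
    (hb0 : ∀ p : ℝ × EuclideanSpace ℝ (Fin d), p.1 ∉ Set.Ioo 0 T → b p = 0) :
    wOneInfNorm d g (fun y => ∫ p, E p.1 (y - p.2) * b p ∂((volume : Measure ℝ).prod ρ)) ≤
      ∫⁻ p, (C * ENNReal.ofReal (p.1 ^ (-β))) * ‖b p‖ₑ ∂((volume : Measure ℝ).prod ρ) := by
  have hN0 : 0 ≤ N := (norm_nonneg _).trans (hN 0)
  refine (wnorm_superpos d g ((volume : Measure ℝ).prod ρ) (fun p y => E p.1 (y - p.2) * b p) ?_
    (fun p => (Set.Ioo 0 T).indicator (fun τ : ℝ => (M * N) * τ ^ (-α)) p.1) ?_ ?_).trans ?_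
  · have e : (Function.uncurry fun (p : ℝ × EuclideanSpace ℝ (Fin d))
        (y : EuclideanSpace ℝ (Fin d)) => E p.1 (y - p.2) * b p) =
        fun r => ((Set.Ioi (0:ℝ) ×ˢ (Set.univ : Set (EuclideanSpace ℝ (Fin d)))).indicator
          (fun p : ℝ × EuclideanSpace ℝ (Fin d) => E p.1 p.2) (r.1.1, r.2 - r.1.2)) * b r.1 := by
      ext ⟨p, y⟩
      simp only [Function.uncurry]
      by_cases hp : p.1 ∈ Set.Ioo 0 T
      · rw [Set.indicator_of_mem]
        exact ⟨hp.1, trivial⟩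
      · rw [hb0 p hp]; simp
    rw [e]
    refine Measurable.mul (hE.meas.comp ?_) (hb.comp measurable_fst)
    exact (measurable_fst.comp measurable_fst).prodMk
      (measurable_snd.sub (measurable_snd.comp measurable_fst))
  · have := (ind_rpow_integrable hT (s := -α) (by linarith [hE.hα]) (M * N)).comp_fst ρ
    exact this
  · intro p y
    by_cases hp : p.1 ∈ Set.Ioo 0 T
    · simp only [Set.indicator_of_mem hp]
      rw [norm_mul]
      calc _ ≤ (M * p.1 ^ (-α)) * N := by
            gcongr
            · have := hE.M0; have := hp.1; positivity
            · exact hE.bound _ hp.1 _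
            · exact hN p
        _ = _ := by ring
    · simp only [Set.indicator_of_notMem hp]
      rw [hb0 p hp]; simp
  · refine lintegral_mono fun p => ?_
    by_cases hp : p.1 ∈ Set.Ioo 0 T
    · refine (wnorm_shift d g (E p.1) p.2 (b p)).trans ?_
      gcongr
      exact hW _ hp.1 hp.2.le
    · refine (wnorm_shift d g (E p.1) p.2 (b p)).trans ?_
      rw [hb0 p hp]; simp

/-- Duhamel source -/
def bb (w : EuclideanSpace ℝ (Fin d) → ℂ) (u : ℝ × EuclideanSpace ℝ (Fin d) → ℂ) (t : ℝ)
    (p : ℝ × EuclideanSpace ℝ (Fin d)) : ℂ :=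
  (Set.Ioo 0 t).indicator (fun τ => u (t - τ, p.2) * w p.2) p.1

lemma bb_meas (hw : Measurable w) {u : ℝ × EuclideanSpace ℝ (Fin d) → ℂ} (hu : Measurable u)
    (t : ℝ) : Measurable (bb d w u t) := by
  have e : bb d w u t = (Set.Ioo 0 t ×ˢ (Set.univ : Set (EuclideanSpace ℝ (Fin d)))).indicator
      (fun p => u (t - p.1, p.2) * w p.2) := by
    ext p
    unfold bb
    by_cases hp : p.1 ∈ Set.Ioo 0 t
    · rw [Set.indicator_of_mem hp, Set.indicator_of_mem]
      exact ⟨hp, trivial⟩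
    · rw [Set.indicator_of_notMem hp, Set.indicator_of_notMem]
      exact fun h => hp h.1
  rw [e]
  refine Measurable.indicator ?_ (measurableSet_Ioo.prod MeasurableSet.univ)
  refine Measurable.mul (hu.comp ?_) (hw.comp measurable_snd)
  exact (measurable_const.sub measurable_fst).prodMk measurable_snd

lemma bb_bound (hw1 : ∀ y, ‖w y‖ ≤ 1) {u : ℝ × EuclideanSpace ℝ (Fin d) → ℂ} {N t : ℝ}
    (hN : 0 ≤ N) (hu : ∀ s, s < t → ∀ y, ‖u (s, y)‖ ≤ N) (p : ℝ × EuclideanSpace ℝ (Fin d)) :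
    ‖bb d w u t p‖ ≤ N := by
  unfold bb
  by_cases hp : p.1 ∈ Set.Ioo 0 t
  · rw [Set.indicator_of_mem hp, norm_mul]
    calc _ ≤ N * 1 := by
          gcongr
          · exact hu _ (by linarith [hp.1]) _
          · exact hw1 _
      _ = N := mul_one N
  · rw [Set.indicator_of_notMem hp]; simpa using hN

lemma bb_zero {u : ℝ × EuclideanSpace ℝ (Fin d) → ℂ} {t T : ℝ} (hT : t ≤ T)
    (p : ℝ × EuclideanSpace ℝ (Fin d)) (hp : p.1 ∉ Set.Ioo 0 T) : bb d w u t p = 0 := by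
  unfold bb
  exact Set.indicator_of_notMem (fun h => hp ⟨h.1, h.2.trans_le hT⟩) _

lemma DI_eq_bb {u : ℝ × EuclideanSpace ℝ (Fin d) → ℂ} (t : ℝ) (x : EuclideanSpace ℝ (Fin d))
    (p : ℝ × EuclideanSpace ℝ (Fin d)) :
    DI E w 0 u (t, x) p = E p.1 (x - p.2) * bb d w u t p := by
  unfold DI bb
  by_cases hp : p.1 ∈ Set.Ioo 0 t
  · simp only [Set.indicator_of_mem hp]; simp; ring
  · simp only [Set.indicator_of_notMem hp]; simp

lemma bound_fin {T β : ℝ} (hT : 0 < T) (hβ : β < 1) {C : ℝ≥0∞} (hC : C ≠ ⊤) (N : ℝ) :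
    ∫⁻ p : ℝ × EuclideanSpace ℝ (Fin d), (C * ENNReal.ofReal N) * ENNReal.ofReal
      ((Set.Ioo 0 T).indicator (fun τ : ℝ => 1 * τ ^ (-β)) p.1) ∂((volume : Measure ℝ).prod ρ)
      ≠ ⊤ := by
  rw [lintegral_const_mul' _ _ (ENNReal.mul_ne_top hC (by simp))]
  refine ENNReal.mul_ne_top (ENNReal.mul_ne_top hC (by simp)) ?_
  have h1 := (ind_rpow_integrable hT (s := -β) (by linarith) 1).comp_fst ρ
  have h2 := h1.2
  refine ((lintegral_mono fun p => ?_).trans_lt h2).ne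
  exact Real.ofReal_le_enorm _

lemma bb_dom {T β : ℝ} {C : ℝ≥0∞} {N : ℝ} {b : ℝ × EuclideanSpace ℝ (Fin d) → ℂ}
    (hN : ∀ p, ‖b p‖ ≤ N)
    (hb0 : ∀ p : ℝ × EuclideanSpace ℝ (Fin d), p.1 ∉ Set.Ioo 0 T → b p = 0)
    (p : ℝ × EuclideanSpace ℝ (Fin d)) :
    (C * ENNReal.ofReal (p.1 ^ (-β))) * ‖b p‖ₑ ≤ (C * ENNReal.ofReal N) * ENNReal.ofReal
      ((Set.Ioo 0 T).indicator (fun τ : ℝ => 1 * τ ^ (-β)) p.1) := by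
  by_cases hp : p.1 ∈ Set.Ioo 0 T
  · rw [Set.indicator_of_mem hp, one_mul, mul_right_comm]
    gcongr
    rw [← ofReal_norm]
    exact ENNReal.ofReal_le_ofReal (hN p)
  · rw [hb0 p hp]; simp

lemma bb_tendsto {u : ℝ × EuclideanSpace ℝ (Fin d) → ℂ} (hu : Continuous u) (t : ℝ)
    (p : ℝ × EuclideanSpace ℝ (Fin d)) (hp : p.1 ≠ t) :
    Filter.Tendsto (fun s => bb d w u s p) (nhds t) (nhds (bb d w u t p)) := by
  rcases lt_or_gt_of_ne hp with h | h
  · by_cases h0 : 0 < p.1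
    · have e : (fun s => u (s - p.1, p.2) * w p.2) =ᶠ[nhds t] fun s => bb d w u s p := by
        filter_upwards [lt_mem_nhds h] with s hs
        unfold bb
        rw [Set.indicator_of_mem (show p.1 ∈ Set.Ioo 0 s from ⟨h0, hs⟩)]
      refine Filter.Tendsto.congr' e ?_
      have e2 : bb d w u t p = u (t - p.1, p.2) * w p.2 := by
        unfold bb
        rw [Set.indicator_of_mem (show p.1 ∈ Set.Ioo 0 t from ⟨h0, h⟩)]
      rw [e2]
      have : Continuous fun s => u (s - p.1, p.2) * w p.2 := by fun_prop
      exact this.tendsto t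
    · have e : ∀ s, bb d w u s p = 0 := fun s => by
        unfold bb
        exact Set.indicator_of_notMem (fun h => h0 h.1) _
      simp only [e]; exact tendsto_const_nhds
  · have e : (fun _ => (0:ℂ)) =ᶠ[nhds t] fun s => bb d w u s p := by
      filter_upwards [gt_mem_nhds h] with s hs
      unfold bb
      rw [Set.indicator_of_notMem]
      exact fun h => lt_asymm hs h.2
    have e2 : bb d w u t p = 0 := by
      unfold bb
      rw [Set.indicator_of_notMem]
      exact fun h' => lt_asymm h h'.2
    rw [e2]
    exact Filter.Tendsto.congr' e tendsto_const_nhds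

lemma duh_cont (hE : KerH E M α) (hw : Measurable w) (hw1 : ∀ y, ‖w y‖ ≤ 1)
    {β : ℝ} (hβ : β < 1)
    (hW : ∀ T, 0 < T → ∃ C : ℝ≥0∞, C ≠ ⊤ ∧ ∀ t, 0 < t → t ≤ T →
      wOneInfNorm d g (E t) ≤ C * ENNReal.ofReal (t ^ (-β)))
    {u : ℝ × EuclideanSpace ℝ (Fin d) → ℂ} (huc : Continuous u)
    (hu : ∀ T, ∃ N, 0 ≤ N ∧ ∀ s, s < T → ∀ y, ‖u (s, y)‖ ≤ N) (t : ℝ) (ht : 0 ≤ t) :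
    wOneInfNorm d g (fun x => ∫ p, DI E w 0 u (t, x) p ∂((volume : Measure ℝ).prod ρ)) < ⊤ ∧
    Filter.Tendsto (fun s => wOneInfNorm d g (fun x =>
      (∫ p, DI E w 0 u (s, x) p ∂((volume : Measure ℝ).prod ρ)) -
      ∫ p, DI E w 0 u (t, x) p ∂((volume : Measure ℝ).prod ρ))) (nhds t) (nhds 0) := by
  have hT : 0 < t + 1 := by linarith
  obtain ⟨C, hC, hCW⟩ := hW (t + 1) hT
  obtain ⟨N, hN0, hN⟩ := hu (t + 1)
  have hbN : ∀ s, s < t + 1 → ∀ p, ‖bb d w u s p‖ ≤ N := fun s hs p =>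
    bb_bound d hw1 hN0 (fun r hr => hN r (hr.trans hs)) p
  have hb0 : ∀ s, s < t + 1 → ∀ p : ℝ × EuclideanSpace ℝ (Fin d), p.1 ∉ Set.Ioo 0 (t + 1) →
    bb d w u s p = 0 := fun s hs p hp => bb_zero d hs.le p hp
  have htt : t < t + 1 := by linarith
  have hbm := fun s => bb_meas d hw huc.measurable s
  constructor
  · simp only [DI_eq_bb]
    refine (duh_W d g ρ hE hT hCW (hbm t) (hbN t htt) (hb0 t htt)).trans_lt ?_
    exact (lintegral_mono (bb_dom d (hbN t htt) (hb0 t htt))).trans_lt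
      (bound_fin d ρ hT hβ hC N).lt_top
  · have hdiffN : ∀ s, s < t + 1 → ∀ p, ‖bb d w u s p - bb d w u t p‖ ≤ N + N := fun s hs p =>
      (norm_sub_le _ _).trans (add_le_add (hbN s hs p) (hbN t htt p))
    have hdiff0 : ∀ s, s < t + 1 → ∀ p : ℝ × EuclideanSpace ℝ (Fin d),
        p.1 ∉ Set.Ioo 0 (t + 1) → bb d w u s p - bb d w u t p = 0 := fun s hs p hp => by
      rw [hb0 s hs p hp, hb0 t htt p hp, sub_zero]
    have hlim : Filter.Tendsto (fun s => ∫⁻ p, (C * ENNReal.ofReal (p.1 ^ (-β))) *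
        ‖bb d w u s p - bb d w u t p‖ₑ ∂((volume : Measure ℝ).prod ρ)) (nhds t) (nhds 0) := by
      have h0 : ∫⁻ _ : ℝ × EuclideanSpace ℝ (Fin d), (0:ℝ≥0∞) ∂((volume : Measure ℝ).prod ρ) = 0 :=
        lintegral_zero
      rw [← h0]
      refine tendsto_lintegral_filter_of_dominated_convergence _ ?_ ?_
        (bound_fin d ρ hT hβ hC (N + N)) ?_
      · refine Filter.Eventually.of_forall fun s => ?_
        have h1 : Measurable fun p : ℝ × EuclideanSpace ℝ (Fin d) =>
          ENNReal.ofReal (p.1 ^ (-β)) := by fun_prop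
        have h2 := ((hbm s).sub (hbm t)).enorm
        exact (h1.const_mul C).mul h2
      · filter_upwards [gt_mem_nhds htt] with s hs
        exact Filter.Eventually.of_forall (bb_dom d (hdiffN s hs) (hdiff0 s hs))
      · have hae : ∀ᵐ p ∂((volume : Measure ℝ).prod ρ), p.1 ≠ t := by
          have h1 : ∀ᵐ τ : ℝ, τ ≠ t := by
            rw [ae_iff]; simp
          exact Measure.quasiMeasurePreserving_fst.ae h1
        filter_upwards [hae] with p hp
        by_cases hp0 : p.1 ∈ Set.Ioo 0 (t + 1)
        · have h1 := ((bb_tendsto d huc t p hp (w := w)).sub_const (bb d w u t p)).enorm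
          rw [sub_self, enorm_zero] at h1
          have h2 := ENNReal.Tendsto.const_mul (a := C * ENNReal.ofReal (p.1 ^ (-β))) h1
            (Or.inr (ENNReal.mul_ne_top hC (by simp)))
          rwa [mul_zero] at h2
        · refine Filter.Tendsto.congr' ?_ tendsto_const_nhds
          filter_upwards [gt_mem_nhds htt] with s hs
          rw [hdiff0 s hs p hp0]; simp
    refine tendsto_of_tendsto_of_tendsto_of_le_of_le' tendsto_const_nhds hlim
      (Filter.Eventually.of_forall fun s => zero_le) ?_
    filter_upwards [gt_mem_nhds htt] with s hs
    have e : (fun x => (∫ p, DI E w 0 u (s, x) p ∂((volume : Measure ℝ).prod ρ)) -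
        ∫ p, DI E w 0 u (t, x) p ∂((volume : Measure ℝ).prod ρ)) = fun x =>
        ∫ p, E p.1 (x - p.2) * (bb d w u s p - bb d w u t p) ∂((volume : Measure ℝ).prod ρ) := by
      ext x
      rw [← integral_sub
        (DI0_integrable ρ hE hw hw1 huc.measurable hN0 (s, x) fun r hr => hN r (hr.trans hs))
        (DI0_integrable ρ hE hw hw1 huc.measurable hN0 (t, x) fun r hr => hN r (hr.trans htt))]
      congr 1; ext p
      rw [DI_eq_bb, DI_eq_bb, mul_sub]
    rw [e]
    exact duh_W d g ρ hE hT hCW ((hbm s).sub (hbm t)) (hdiffN s hs) (hdiff0 s hs)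

end duhW

open MeasureTheory Real Complex
open scoped ENNReal RealInnerProductSpace

set_option linter.unusedSectionVars false

noncomputable section

section uniq

variable (d : ℕ) (g : SchwartzMap (EuclideanSpace ℝ (Fin d)) ℂ)

open FourierTransform in
lemma sup_le_wnorm {v : EuclideanSpace ℝ (Fin d) → ℂ} (hv : Continuous v) {M : ℝ}
    (hM : ∀ x, ‖v x‖ ≤ M) (x : EuclideanSpace ℝ (Fin d)) :
    ‖v x‖ₑ * ‖g 0‖ₑ ≤ wOneInfNorm d g v := by
  by_cases hfin : ∫⁻ ξ, ‖gaborT d g v x ξ‖ₑ = ⊤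
  · have : wOneInfNorm d g v = ⊤ := by
      rw [wnorm_eq]
      exact top_le_iff.1 (hfin ▸ le_iSup (fun x => ∫⁻ ξ, ‖gaborT d g v x ξ‖ₑ) x)
    rw [this]; exact le_top
  set F : EuclideanSpace ℝ (Fin d) → ℂ := fun y => v y * (starRingEnd ℂ) (g (y - x)) with hF
  have hFc : Continuous F :=
    hv.mul (Complex.continuous_conj.comp (g.continuous.comp (by fun_prop)))
  have hFi : Integrable F := by
    have := gaborT_integrable d g hv.measurable hM x 0
    refine this.congr (Filter.Eventually.of_forall fun y => ?_)
    simp [testfn_apply, hF, ex_zero]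
  have hFF : 𝓕 F = fun ξ => gaborT d g v x ξ := by
    ext ξ
    rw [gaborT_eq, Real.fourier_eq']
    congr 1; ext y
    rw [testfn_apply, smul_eq_mul, ex_neg, hF, real_inner_comm]
    have : ((-2 * Real.pi * ⟪ξ, y⟫ : ℝ) : ℂ) * Complex.I =
      -(((2 * Real.pi * ⟪ξ, y⟫ : ℝ) : ℂ) * Complex.I) := by push_cast; ring
    rw [this]; ring
  have hFFi : Integrable (𝓕 F) := by
    rw [hFF]
    exact ⟨(gaborT_meas d g hv.measurable x).aestronglyMeasurable, lt_top_iff_ne_top.2 hfin⟩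
  have h1 := hFi.fourierInv_fourier_eq hFFi (hFc.continuousAt (x := x))
  have h2 : ‖F x‖ₑ = ‖v x‖ₑ * ‖g 0‖ₑ := by
    rw [hF]; simp only [enorm_mul, sub_self]
    congr 1
    rw [← ofReal_norm, ← ofReal_norm, RCLike.norm_conj]
  rw [← h2, ← h1, Real.fourierInv_eq']
  refine (enorm_integral_le_lintegral_enorm _).trans ?_
  rw [wnorm_eq]
  refine le_trans (lintegral_mono fun ξ => ?_)
    (le_iSup (fun x => ∫⁻ ξ, ‖gaborT d g v x ξ‖ₑ) x)
  rw [hFF, smul_eq_mul, enorm_mul]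
  have : ‖Complex.exp (((2 * Real.pi * ⟪ξ, x⟫ : ℝ) : ℂ) * Complex.I)‖ₑ = 1 := by
    rw [← ofReal_norm, Complex.norm_exp_ofReal_mul_I]; simp
  rw [this, one_mul]

variable {d g} {μ : EuclideanSpace ℝ (Fin d) → ℝ}
  {E : ℝ → EuclideanSpace ℝ (Fin d) → ℂ} {M α : ℝ} {w : EuclideanSpace ℝ (Fin d) → ℂ}
  {ρ : Measure (EuclideanSpace ℝ (Fin d))} [IsFiniteMeasure ρ]
  {h : EuclideanSpace ℝ (Fin d) → ℂ}

lemma sol_bdd (hg : g 0 ≠ 0) {u : ℝ → EuclideanSpace ℝ (Fin d) → ℂ}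
    (hu : IsGlobalSolution d μ g E ρ w h u) (T : ℝ) :
    ∃ N, ∀ t ∈ Set.Icc 0 T, ∀ x, ‖u t x‖ ≤ N := by
  refine isCompact_Icc.induction_on (p := fun S => ∃ N, ∀ t ∈ S, ∀ x, ‖u t x‖ ≤ N) ?_ ?_ ?_ ?_
  · exact ⟨0, fun t ht => ht.elim⟩
  · rintro S S' hS ⟨N, hN⟩
    exact ⟨N, fun t ht => hN t (hS ht)⟩
  · rintro S S' ⟨N, hN⟩ ⟨N', hN'⟩
    refine ⟨max N N', fun t ht x => ?_⟩
    rcases ht with ht | ht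
    · exact (hN t ht x).trans (le_max_left _ _)
    · exact (hN' t ht x).trans (le_max_right _ _)
  · intro t ht
    have ht0 : t ∈ Set.Ici (0:ℝ) := ht.1
    obtain ⟨hc, ⟨N, hN⟩, -⟩ := hu.1 t ht0
    have hg' : 0 < ‖g 0‖ := norm_pos_iff.2 hg
    obtain ⟨δ, hδ, hcont⟩ := hu.2.1 t ht0 ‖g 0‖ hg'
    refine ⟨Set.Icc 0 T ∩ {s | |s - t| < δ}, ?_, N + 1, ?_⟩
    · refine inter_mem_nhdsWithin _ ?_
      have : {s | |s - t| < δ} = Metric.ball t δ := by ext s; simp [Real.dist_eq]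
      rw [this]; exact Metric.ball_mem_nhds t hδ
    · rintro s ⟨hs, hst⟩ x
      have hs0 : s ∈ Set.Ici (0:ℝ) := hs.1
      obtain ⟨hc', ⟨N', hN'⟩, -⟩ := hu.1 s hs0
      have h1 := hcont s hs0 hst
      have h2 := (sup_le_wnorm d g (hc'.sub hc) (M := N' + N)
        (fun x => (norm_sub_le _ _).trans (add_le_add (hN' x) (hN x))) x).trans h1.le
      rw [← enorm_mul, ← ofReal_norm, ENNReal.ofReal_le_ofReal_iff hg'.le, norm_mul] at h2
      rw [Pi.sub_apply] at h2
      have h3 : ‖u s x - u t x‖ ≤ 1 := by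
        by_contra hcon
        push Not at hcon
        nlinarith
      calc ‖u s x‖ = ‖u t x + (u s x - u t x)‖ := by congr 1; ring
        _ ≤ ‖u t x‖ + ‖u s x - u t x‖ := norm_add_le _ _
        _ ≤ N + 1 := add_le_add (hN x) h3

lemma sol_unique (hg : g 0 ≠ 0) (hE : KerH E M α) (hw1 : ∀ y, ‖w y‖ ≤ 1)
    {u u' : ℝ → EuclideanSpace ℝ (Fin d) → ℂ}
    (hu : IsGlobalSolution d μ g E ρ w h u) (hu' : IsGlobalSolution d μ g E ρ w h u')
    (t : ℝ) (ht : t ∈ Set.Ici (0:ℝ)) (x : EuclideanSpace ℝ (Fin d)) : u' t x = u t x := by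
  obtain ⟨Λ, hΛ, hhalf⟩ := exists_weight M α (2 * Real.pi * ρ.real Set.univ) hE.hα
  set T := t
  obtain ⟨N, hN⟩ := sol_bdd hg hu T
  obtain ⟨N', hN'⟩ := sol_bdd hg hu' T
  have hstep : ∀ K : ℝ, 0 ≤ K →
      (∀ s ∈ Set.Icc 0 T, ∀ x, ‖u' s x - u s x‖ ≤ K * Real.exp (Λ * s)) →
      ∀ s ∈ Set.Icc 0 T, ∀ x, ‖u' s x - u s x‖ ≤ K / 2 * Real.exp (Λ * s) := by
    intro K hK hKb t ht x
    rcases ht.1.eq_or_lt with h0 | h0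
    · rw [← h0, hu.2.2.1, hu'.2.2.1, sub_self, norm_zero]; positivity
    obtain ⟨a1, a2, a3⟩ := hu.2.2.2 t h0 x
    obtain ⟨b1, b2, b3⟩ := hu'.2.2.2 t h0 x
    have hdom : Integrable fun s => domf M α Λ (t - s) :=
      (domf_integrable hE.hα hΛ).comp_sub_left t
    have hint : ‖(∫ s in Set.Ioo (0 : ℝ) t, ∫ y, E (t - s) (x - y) * u' s y * w y ∂ρ) -
        ∫ s in Set.Ioo (0 : ℝ) t, ∫ y, E (t - s) (x - y) * u s y * w y ∂ρ‖ ≤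
        (K * Real.exp (Λ * t) * ρ.real Set.univ) * ∫ τ, domf M α Λ τ := by
      rw [← integral_sub b2 a2, ← integral_sub_left_eq_self (domf M α Λ) volume t,
        ← integral_const_mul]
      refine (norm_integral_le_of_norm_le (hdom.const_mul _).integrableOn
        (g := fun s => (K * Real.exp (Λ * t) * ρ.real Set.univ) * domf M α Λ (t - s)) ?_).trans ?_
      · refine (ae_restrict_iff' measurableSet_Ioo).2 (Filter.Eventually.of_forall fun s hs => ?_)
        have hts : 0 < t - s := by linarith [hs.2]
        rw [← integral_sub (b1 s hs) (a1 s hs)]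
        have hb : ∀ y, ‖E (t - s) (x - y) * u' s y * w y - E (t - s) (x - y) * u s y * w y‖ ≤
            (M * (t - s) ^ (-α)) * (K * Real.exp (Λ * s)) * 1 := by
          intro y
          rw [← sub_mul, ← mul_sub, norm_mul, norm_mul]
          have := hE.M0
          gcongr
          · exact hE.bound _ hts _
          · exact hKb s ⟨hs.1.le, hs.2.le.trans ht.2⟩ y
          · exact hw1 y
        refine (norm_integral_le_of_norm_le_const (Filter.Eventually.of_forall hb)).trans
          (le_of_eq ?_)
        rw [domf, Set.indicator_of_mem (show t - s ∈ Set.Ioi 0 from hts)]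
        have : Real.exp (Λ * s) = Real.exp (Λ * t) * Real.exp (-(Λ * (t - s))) := by
          rw [← Real.exp_add]; congr 1; ring
        rw [this]; ring
      · refine setIntegral_le_integral (hdom.const_mul _) (Filter.Eventually.of_forall fun s => ?_)
        have := domf_nonneg (α := α) (Λ := Λ) hE.M0 (t - s)
        show 0 ≤ _
        positivity
    rw [a3, b3, add_sub_add_left_eq_sub, ← mul_sub, norm_mul]
    have hcoef : ‖(2 * (Real.pi : ℂ)) * Complex.I‖ = 2 * Real.pi := by
      simp [abs_of_pos Real.pi_pos]
    rw [hcoef]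
    calc _ ≤ 2 * Real.pi * ((K * Real.exp (Λ * t) * ρ.real Set.univ) * ∫ τ, domf M α Λ τ) := by
          gcongr
      _ = (2 * Real.pi * ρ.real Set.univ * ∫ τ, domf M α Λ τ) * (K * Real.exp (Λ * t)) := by ring
      _ ≤ 1 / 2 * (K * Real.exp (Λ * t)) := by gcongr
      _ = _ := by ring
  set K0 := max (N' + N) 0 with hK0
  have hall : ∀ n : ℕ, ∀ s ∈ Set.Icc 0 T, ∀ x,
      ‖u' s x - u s x‖ ≤ K0 * (1 / 2) ^ n * Real.exp (Λ * s) := by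
    intro n
    induction n with
    | zero =>
      intro s hs x
      have h1 : ‖u' s x - u s x‖ ≤ K0 :=
        ((norm_sub_le _ _).trans (add_le_add (hN' s hs x) (hN s hs x))).trans (le_max_left _ _)
      have h2 : 1 ≤ Real.exp (Λ * s) := Real.one_le_exp (mul_nonneg hΛ.le hs.1)
      have h3 : 0 ≤ K0 := le_max_right _ _
      simp only [pow_zero, mul_one]
      nlinarith
    | succ n ih =>
      intro s hs x
      have h3 : 0 ≤ K0 := le_max_right _ _
      refine (hstep _ (by positivity) ih s hs x).trans (le_of_eq ?_)
      rw [pow_succ]; ring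
  have hlim : Filter.Tendsto (fun n : ℕ => K0 * (1 / 2) ^ n * Real.exp (Λ * T)) Filter.atTop
      (nhds (K0 * 0 * Real.exp (Λ * T))) :=
    ((tendsto_pow_atTop_nhds_zero_of_lt_one (by norm_num) (by norm_num)).const_mul _).mul_const _
  rw [mul_zero, zero_mul] at hlim
  have h0 := ge_of_tendsto' hlim fun n => hall n T ⟨ht, le_rfl⟩ x
  exact sub_eq_zero.1 (norm_le_zero_iff.1 h0)

end uniq

open MeasureTheory Real Complex
open scoped ENNReal RealInnerProductSpace

set_option linter.unusedSectionVars false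

noncomputable section

section free

variable (d : ℕ) (g : SchwartzMap (EuclideanSpace ℝ (Fin d)) ℂ)
  {μ : EuclideanSpace ℝ (Fin d) → ℝ} {h : EuclideanSpace ℝ (Fin d) → ℂ}

/-- free evolution -/
def uF (μ : EuclideanSpace ℝ (Fin d) → ℝ) (h : EuclideanSpace ℝ (Fin d) → ℂ)
    (q : ℝ × EuclideanSpace ℝ (Fin d)) : ℂ :=
  ∫ ξ, ex (⟪q.2, ξ⟫ + q.1 * μ ξ) * h ξ

lemma uF_integrable (hμ : Measurable μ) (hh : Integrable h) (q : ℝ × EuclideanSpace ℝ (Fin d)) :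
    Integrable fun ξ => ex (⟪q.2, ξ⟫ + q.1 * μ ξ) * h ξ :=
  ex_mul_integrable hh (by fun_prop)

lemma uF_bound (q : ℝ × EuclideanSpace ℝ (Fin d)) : ‖uF d μ h q‖ ≤ ∫ ξ, ‖h ξ‖ := by
  refine (norm_integral_le_integral_norm _).trans (le_of_eq ?_)
  simp only [norm_mul, norm_ex, one_mul]

lemma uF_cont (hμ : Measurable μ) (hh : Integrable h) : Continuous (uF d μ h) := by
  refine continuous_of_dominated (bound := fun ξ => ‖h ξ‖)
    (fun q => (uF_integrable d hμ hh q).1) (fun q => Filter.Eventually.of_forall fun ξ => ?_)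
    hh.norm (Filter.Eventually.of_forall fun ξ => ?_)
  · rw [norm_mul, norm_ex, one_mul]
  · have : Continuous fun q : ℝ × EuclideanSpace ℝ (Fin d) => ex (⟪q.2, ξ⟫ + q.1 * μ ξ) :=
      continuous_ex.comp (by fun_prop)
    exact this.mul continuous_const

lemma uF_eq (t : ℝ) (y : EuclideanSpace ℝ (Fin d)) :
    uF d μ h (t, y) = ∫ ξ, ex ⟪y, ξ⟫ * (ex (t * μ ξ) * h ξ) := by
  unfold uF
  congr 1; ext ξ
  rw [ex_add, mul_assoc]

lemma uF_wfin (hμ : Measurable μ) (hh : Integrable h) (t : ℝ) :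
    wOneInfNorm d g (fun y => uF d μ h (t, y)) < ⊤ := by
  simp only [uF_eq]
  have hi : Integrable fun ξ => ex (t * μ ξ) * h ξ := ex_mul_integrable hh (by fun_prop)
  exact (wnorm_free d g hi).trans_lt (ENNReal.mul_lt_top (psi_fin d g) hi.2)

lemma uF_wcont (hμ : Measurable μ) (hh : Integrable h) (t : ℝ) :
    Filter.Tendsto (fun s => wOneInfNorm d g (fun y => uF d μ h (s, y) - uF d μ h (t, y)))
      (nhds t) (nhds 0) := by
  have hi : ∀ s, Integrable fun ξ => ex (s * μ ξ) * h ξ :=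
    fun s => ex_mul_integrable hh (by fun_prop)
  have hlim : Filter.Tendsto (fun s => ∫⁻ ξ, ‖ex (s * μ ξ) * h ξ - ex (t * μ ξ) * h ξ‖ₑ)
      (nhds t) (nhds 0) := by
    have hr : Filter.Tendsto (fun s => ∫ ξ, ‖ex (s * μ ξ) * h ξ - ex (t * μ ξ) * h ξ‖)
        (nhds t) (nhds (∫ _ : EuclideanSpace ℝ (Fin d), (0:ℝ))) := by
      refine tendsto_integral_filter_of_dominated_convergence (fun ξ => ‖h ξ‖ + ‖h ξ‖) ?_ ?_
        (hh.norm.add hh.norm) ?_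
      · exact Filter.Eventually.of_forall fun s => ((hi s).1.sub (hi t).1).norm
      · refine Filter.Eventually.of_forall fun s => Filter.Eventually.of_forall fun ξ => ?_
        rw [norm_norm]
        refine (norm_sub_le _ _).trans ?_
        simp [norm_mul]
      · refine Filter.Eventually.of_forall fun ξ => ?_
        have hc : Continuous fun s : ℝ => ‖ex (s * μ ξ) * h ξ - ex (t * μ ξ) * h ξ‖ := by
          have : Continuous fun s : ℝ => ex (s * μ ξ) := continuous_ex.comp (by fun_prop)
          fun_prop
        have := hc.tendsto t
        simpa using this
    rw [integral_zero] at hr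
    have h2 := ENNReal.tendsto_ofReal hr
    rw [ENNReal.ofReal_zero] at h2
    refine h2.congr fun s => ?_
    exact ofReal_integral_norm_eq_lintegral_enorm ((hi s).sub (hi t))
  have hlim2 := ENNReal.Tendsto.const_mul (a := ∫⁻ η, ‖psi g η‖ₑ) hlim
    (Or.inr (psi_fin d g).ne)
  rw [mul_zero] at hlim2
  refine tendsto_of_tendsto_of_tendsto_of_le_of_le tendsto_const_nhds hlim2
    (fun s => zero_le) fun s => ?_
  have e : (fun y => uF d μ h (s, y) - uF d μ h (t, y)) = fun y =>
      ∫ ξ, ex ⟪y, ξ⟫ * (ex (s * μ ξ) * h ξ - ex (t * μ ξ) * h ξ) := by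
    ext y
    rw [uF_eq, uF_eq, ← integral_sub]
    · congr 1; ext ξ; ring
    · exact ex_mul_integrable (hi s) (by fun_prop)
    · exact ex_mul_integrable (hi t) (by fun_prop)
  simp only [e]
  exact wnorm_free d g ((hi s).sub (hi t))

end free

open MeasureTheory Real Complex
open scoped ENNReal RealInnerProductSpace

noncomputable section

/-- (Theorem 1.3, second part: global wellposedness of the linear problem
with a time-independent finite complex measure potential.) Under hypotheses (H) with `m > 2d`,
every datum `f = (h)^∨` with `h ∈ L¹` admits a unique global solution
`u ∈ C⁰([0,∞); W^{1,∞})` of the Duhamel equation. -/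
theorem global_linear_wellposedness (d : ℕ) (hd : 1 ≤ d) (m : ℝ) (hm : 2 ≤ m)
    (hmd : 2 * (d : ℝ) < m)
    (μ : EuclideanSpace ℝ (Fin d) → ℝ)
    (hsmooth : ContDiffOn ℝ (⊤ : ℕ∞) μ {x | x ≠ 0})
    (hhom : ∀ c : ℝ, 0 < c → ∀ x : EuclideanSpace ℝ (Fin d), x ≠ 0 →
      μ (c • x) = c ^ m * μ x)
    (hhess : ∀ x : EuclideanSpace ℝ (Fin d), ‖x‖ = 1 →
      Function.Bijective ⇑(fderiv ℝ (fderiv ℝ μ) x))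
    (g : SchwartzMap (EuclideanSpace ℝ (Fin d)) ℂ) (hg : g 0 ≠ 0)
    (EE : ℝ → EuclideanSpace ℝ (Fin d) → ℂ)
    (hEE : ∀ t : ℝ, 0 < t → Continuous (EE t) ∧ (∃ M : ℝ, ∀ x, ‖EE t x‖ ≤ M) ∧
      ∀ φ : SchwartzMap (EuclideanSpace ℝ (Fin d)) ℂ,
        ∫ x, EE t x * φ x =
          ∫ (ξ : EuclideanSpace ℝ (Fin d)),
            Complex.exp (((2 * Real.pi * (t * μ ξ) : ℝ) : ℂ) * Complex.I) *
              ∫ x, Complex.exp (((2 * Real.pi * ⟪ξ, x⟫ : ℝ) : ℂ) * Complex.I) * φ x)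
    (ρ : Measure (EuclideanSpace ℝ (Fin d))) [IsFiniteMeasure ρ]
    (w : EuclideanSpace ℝ (Fin d) → ℂ) (hwm : Measurable w) (hw1 : ∀ y, ‖w y‖ ≤ 1)
    (h : EuclideanSpace ℝ (Fin d) → ℂ) (hh : Integrable h) :
    ∃ u : ℝ → EuclideanSpace ℝ (Fin d) → ℂ,
      IsGlobalSolution d μ g EE ρ w h u ∧
      ∀ u' : ℝ → EuclideanSpace ℝ (Fin d) → ℂ,
        IsGlobalSolution d μ g EE ρ w h u' →
        ∀ t ∈ Set.Ici (0 : ℝ), ∀ x, u' t x = u t x := by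
  have hne : Nonempty (Fin d) := ⟨⟨0, hd⟩⟩
  have hnt : Nontrivial (EuclideanSpace ℝ (Fin d)) := inferInstance
  have hm0 : 0 < m := by linarith
  have hd0 : (1:ℝ) ≤ d := by exact_mod_cast hd
  have hK : ∀ t : ℝ, 0 < t → IsKer μ t (EE t) := hEE
  have hμ : Measurable μ := meas_phase hsmooth
  obtain ⟨M, hM0, hMb⟩ := ker_bound hm0 hhom hK
  have hα : (d : ℝ) / m < 1 := by rw [div_lt_one hm0]; linarith
  have hβ : 2 * (d : ℝ) / m < 1 := by rw [div_lt_one hm0]; linarith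
  have hE : KerH EE M ((d : ℝ) / m) := by
    refine ⟨hM0, hα, fun t ht x => ?_, ker_cont hm0 hhom hK⟩
    have := hMb t ht x
    rwa [finrank_euclideanSpace_fin] at this
  have hW : ∀ T, 0 < T → ∃ C : ℝ≥0∞, C ≠ ⊤ ∧ ∀ t, 0 < t → t ≤ T →
      wOneInfNorm d g (EE t) ≤ C * ENNReal.ofReal (t ^ (-(2 * (d : ℝ) / m))) := by
    intro T hT
    obtain ⟨C, hC, hCb⟩ := W_kernel d hd m hm μ hsmooth hhom hhess g EE hK T hT
    exact ⟨C, hC, fun t ht htT => iSup_le fun x => hCb t ht htT x⟩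
  have hFc := uF_cont d hμ hh
  have hFb := uF_bound d (μ := μ) (h := h)
  obtain ⟨u, huc, ⟨Λ, A, hΛ, hA, hub⟩, hueq⟩ := exists_mild ρ hE hwm hw1 hFc hFb
  have hu : ∀ T, ∃ N, 0 ≤ N ∧ ∀ s, s < T → ∀ y, ‖u (s, y)‖ ≤ N := fun T =>
    ⟨A * Real.exp (Λ * T), by positivity, fun s hs y => (hub s y).trans (by gcongr)⟩
  have hD := fun t ht => duh_cont d g ρ hE hwm hw1 hβ hW huc hu t ht
  set D : ℝ → EuclideanSpace ℝ (Fin d) → ℂ := fun t x =>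
    ∫ p, DI EE w 0 u (t, x) p ∂((volume : Measure ℝ).prod ρ) with hDdef
  set c : ℂ := (2 * (Real.pi : ℂ)) * Complex.I with hc
  have hR : ∀ t, 0 ≤ t → ∀ y, u (t, y) - uF d μ h (t, y) = D t (y - 0) * c := by
    intro t ht y
    rw [hueq t ht y, sub_zero]; ring
  have hutc : ∀ t, Continuous fun y => u (t, y) := fun t => huc.comp (by fun_prop)
  have hFtc : ∀ t, Continuous fun y => uF d μ h (t, y) := fun t => hFc.comp (by fun_prop)
  have hsol : IsGlobalSolution d μ g EE ρ w h (fun t x => u (t, x)) := by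
    refine ⟨fun t ht => ⟨hutc t, ⟨_, hub t⟩, ?_⟩, fun t ht ε hε => ?_, fun x => ?_,
      fun t ht x => ?_⟩
    · have e : (fun x => u (t, x)) = fun x => uF d μ h (t, x) + (u (t, x) - uF d μ h (t, x)) := by
        ext x; ring
      change wOneInfNorm d g (fun x => u (t, x)) < ⊤
      rw [e]
      refine (wnorm_add d g (hFtc t).measurable (fun x => hFb (t, x))
        ((hutc t).sub (hFtc t)).measurable (fun x => (norm_sub_le _ _).trans
          (add_le_add (hub t x) (hFb (t, x))))).trans_lt ?_
      refine ENNReal.add_lt_top.2 ⟨uF_wfin d g hμ hh t, ?_⟩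
      have e2 : (fun x => u (t, x) - uF d μ h (t, x)) = fun y => D t (y - 0) * c :=
        funext (hR t ht)
      change wOneInfNorm d g (fun x => u (t, x) - uF d μ h (t, x)) < ⊤
      rw [e2]
      exact (wnorm_shift d g (D t) 0 c).trans_lt (ENNReal.mul_lt_top (hD t ht).1 (by simp))
    · have h1 := ENNReal.Tendsto.mul_const (b := ‖c‖ₑ) (hD t ht).2 (Or.inr (by simp))
      have h2 := (uF_wcont d g hμ hh t).add h1
      rw [zero_mul, add_zero] at h2
      have h3 := h2.eventually (gt_mem_nhds (ENNReal.ofReal_pos.2 hε))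
      obtain ⟨δ, hδ, hball⟩ := Metric.eventually_nhds_iff.1 h3
      refine ⟨δ, hδ, fun s hs hst => ?_⟩
      refine lt_of_le_of_lt ?_ (hball (by rwa [Real.dist_eq]))
      have e : (fun x => u (s, x) - u (t, x)) = fun x =>
          (uF d μ h (s, x) - uF d μ h (t, x)) + ((fun x => D s x - D t x) (x - 0) * c) := by
        ext x
        have r1 := hR s hs x
        have r2 := hR t ht x
        simp only [sub_mul, ← r1, ← r2]; ring
      have e3 : ∀ x, (fun x => D s x - D t x) (x - 0) * c =
          (u (s, x) - uF d μ h (s, x)) - (u (t, x) - uF d μ h (t, x)) := by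
        intro x
        rw [hR s hs x, hR t ht x, sub_mul]
      have hb2 : ∀ x, ‖(fun x => D s x - D t x) (x - 0) * c‖ ≤
          (A * Real.exp (Λ * s) + ∫ ξ, ‖h ξ‖) + (A * Real.exp (Λ * t) + ∫ ξ, ‖h ξ‖) := by
        intro x
        rw [e3]
        exact (norm_sub_le _ _).trans (add_le_add
          ((norm_sub_le _ _).trans (add_le_add (hub s x) (hFb (s, x))))
          ((norm_sub_le _ _).trans (add_le_add (hub t x) (hFb (t, x)))))
      have hm2 : Measurable fun x => (fun x => D s x - D t x) (x - 0) * c := by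
        rw [funext e3]
        exact (((hutc s).sub (hFtc s)).sub ((hutc t).sub (hFtc t))).measurable
      rw [e]
      refine (wnorm_add d g ((hFtc s).sub (hFtc t)).measurable
        (fun x => (norm_sub_le _ _).trans (add_le_add (hFb (s, x)) (hFb (t, x)))) hm2 hb2).trans ?_
      exact add_le_add le_rfl (wnorm_shift d g (fun x => D s x - D t x) 0 c)
    · have h1 := hueq 0 le_rfl x
      have h2 : ∀ p, DI EE w 0 u (0, x) p = 0 := fun p => by simp [DI]
      change u (0, x) = _
      rw [h1]
      simp only [h2, integral_zero, mul_zero, add_zero]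
      unfold uF
      congr 1; ext ξ
      simp [ex]
    · obtain ⟨N, hN0, hN⟩ := hu t
      obtain ⟨i1, i2, i3⟩ := DO_iter ρ hE hwm hw1 huc.measurable hN0 t x hN
      refine ⟨i1, i2, ?_⟩
      rw [← i3]
      exact hueq t ht.le x
  exact ⟨fun t x => u (t, x), hsol, fun u' hu' t ht x => sol_unique hg hE hw1 hsol hu' t ht x⟩
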